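/- Let R be a commutative Noetherian ring, M a finitely generated R-module of finite dimension d, and P a finite set of maximal ideals of R. Let 𝔐 = ∩_{m ∈ P} m and let T denote the 𝔐-adic completion of R. Then, as c ranges over all ideals of R with Supp_R H^d_c(M) = P, the number of isomorphism classes of R-modules among the top local cohomology modules H^d_c(M) is at most 2^{|Assh_T(M ⊗_R T)|}. -/

import Mathlib

/- Common definitions: local cohomology modules, cohomological dimension, module dimension,
secondary representations and attached primes. -/

open CategoryTheory TensorProduct

/-- The `i`-th local cohomology module `H^i_a(M)`, as a type with its `R`-module structure. -/
noncomputable def TopLC (R : Type) [CommRing R] (a : Ideal R) (i : ℕ)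
    (M : Type) [AddCommGroup M] [Module R M] : Type :=
  ((localCohomology a i).obj (ModuleCat.of R M))

noncomputable instance (R : Type) [CommRing R] (a : Ideal R) (i : ℕ)
    (M : Type) [AddCommGroup M] [Module R M] : AddCommGroup (TopLC R a i M) :=
  inferInstanceAs (AddCommGroup ((localCohomology a i).obj (ModuleCat.of R M)))

noncomputable instance (R : Type) [CommRing R] (a : Ideal R) (i : ℕ)
    (M : Type) [AddCommGroup M] [Module R M] : Module R (TopLC R a i M) :=
  inferInstanceAs (Module R ((localCohomology a i).obj (ModuleCat.of R M)))

/-- The cohomological dimension `cd_R(a, M) = sup { i | H^i_a(M) ≠ 0 }`,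
with value `⊥` if all local cohomology modules vanish. -/
noncomputable def cohDim (R : Type) [CommRing R] (a : Ideal R)
    (M : Type) [AddCommGroup M] [Module R M] : WithBot ℕ∞ :=
  sSup {n : WithBot ℕ∞ | ∃ i : ℕ, n = (i : ℕ) ∧ Nontrivial (TopLC R a i M)}

/-- The (Krull) dimension of a module, i.e. the Krull dimension of its support. -/
noncomputable def moduleDim (R : Type) [CommRing R]
    (M : Type) [AddCommGroup M] [Module R M] : WithBot ℕ∞ :=
  Order.krullDim (Module.support R M)

/-- `Assh_R M`: the associated primes `p` of `M` with `dim R/p = dim M`. -/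
noncomputable def Assh (R : Type) [CommRing R]
    (M : Type) [AddCommGroup M] [Module R M] : Set (Ideal R) :=
  { p | p ∈ associatedPrimes R M ∧ ringKrullDim (R ⧸ p) = moduleDim R M }

/-- A submodule `S` is secondary if `S ≠ 0` and every `r : R` acts on `S` either
surjectively or nilpotently. -/
def IsSecondarySub (R : Type) [CommRing R] {M : Type} [AddCommGroup M] [Module R M]
    (S : Submodule R M) : Prop :=
  S ≠ ⊥ ∧ ∀ r : R, (∀ m ∈ S, ∃ s ∈ S, r • s = m) ∨ (∃ n : ℕ, ∀ m ∈ S, r ^ n • m = 0)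

/-- A module is representable if it is the (finite) sum of secondary submodules. -/
def IsRepresentable (R : Type) [CommRing R] (M : Type) [AddCommGroup M] [Module R M] : Prop :=
  ∃ (n : ℕ) (S : Fin n → Submodule R M), (∀ i, IsSecondarySub R (S i)) ∧ (⨆ i, S i) = ⊤

/-- A minimal secondary representation: secondary submodules summing to the whole module,
with pairwise distinct attached primes, none contained in the sum of the others. -/
def IsMinimalRep (R : Type) [CommRing R] {M : Type} [AddCommGroup M] [Module R M]
    {n : ℕ} (S : Fin n → Submodule R M) : Prop :=
  (∀ i, IsSecondarySub R (S i)) ∧ (⨆ i, S i) = ⊤ ∧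
    (Function.Injective fun i => (S i).annihilator.radical) ∧
    ∀ j, ¬ (S j ≤ ⨆ i ∈ ({j}ᶜ : Set (Fin n)), S i)

/-- The attached primes of a module: the radicals of the annihilators of the terms of a
minimal secondary representation. -/
def AttachedPrimes (R : Type) [CommRing R] (M : Type) [AddCommGroup M] [Module R M] :
    Set (Ideal R) :=
  { p | ∃ (n : ℕ) (S : Fin n → Submodule R M), IsMinimalRep R S ∧
      ∃ i, p = (S i).annihilator.radical }

/-- `stab b N = ⟨b⟩N = ⋂ₙ bⁿN`. -/
def stab {R M : Type} [CommRing R] [AddCommGroup M] [Module R M]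
    (b : Ideal R) (N : Submodule R M) : Submodule R M :=
  ⨅ n : ℕ, b ^ n • N

open Opposite

namespace LC

section

variable {A : Type} [CommRing A]

noncomputable def spn {H : (ModuleCat.{0} A)ᵒᵖ} (x : H.unop) : H ⟶ op (ModuleCat.of A A) :=
  (ModuleCat.ofHom (LinearMap.toSpanSingleton A H.unop x)).op

noncomputable def ev {H : (ModuleCat.{0} A)ᵒᵖ} (f : H ⟶ op (ModuleCat.of A A)) : H.unop :=
  f.unop.hom 1

lemma ev_spn {H : (ModuleCat.{0} A)ᵒᵖ} (x : H.unop) : ev (spn x) = x := by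
  simp [ev, spn]

lemma spn_ev {H : (ModuleCat.{0} A)ᵒᵖ} (f : H ⟶ op (ModuleCat.of A A)) : spn (ev f) = f := by
  apply Quiver.Hom.unop_inj
  ext
  simp [ev, spn]

lemma ev_comp {H H' : (ModuleCat.{0} A)ᵒᵖ} (g : H ⟶ H') (f : H' ⟶ op (ModuleCat.of A A)) :
    ev (g ≫ f) = g.unop.hom (ev f) := by
  simp [ev]

lemma comp_spn {H H' : (ModuleCat.{0} A)ᵒᵖ} (g : H ⟶ H') (x : H'.unop) :
    g ≫ spn x = spn (g.unop.hom x) := by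
  rw [← spn_ev (g ≫ spn x), ev_comp, ev_spn]

lemma ev_add {H : (ModuleCat.{0} A)ᵒᵖ} (f g : H ⟶ op (ModuleCat.of A A)) :
    ev (f + g) = ev f + ev g := by
  simp [ev]

lemma spn_add {H : (ModuleCat.{0} A)ᵒᵖ} (x y : H.unop) : spn (x + y) = spn x + spn y := by
  rw [← spn_ev (spn x + spn y), ev_add, ev_spn, ev_spn]

lemma spn_zero {H : (ModuleCat.{0} A)ᵒᵖ} : spn (0 : H.unop) = 0 := by
  rw [← spn_ev (0 : H ⟶ op (ModuleCat.of A A))]; simp [ev]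

lemma spn_inj {H : (ModuleCat.{0} A)ᵒᵖ} {x y : H.unop} (h : spn x = spn y) : x = y := by
  rw [← ev_spn x, h, ev_spn]

variable (K L : ChainComplex (ModuleCat.{0} A)ᵒᵖ ℕ) (n : ℕ)

noncomputable def hcls (x : (K.X n).unop) (hx : (K.d (n + 1) n).unop.hom x = 0) : (K.homology n).unop :=
  ev (K.homologyι n ≫ K.descOpcycles (spn x) (n + 1) (by simp) (by rw [comp_spn, hx, spn_zero]))

lemma hcls_add (x y : (K.X n).unop) (hx hy) :
    hcls K n (x + y) (by rw [map_add, hx, hy, add_zero]) = hcls K n x hx + hcls K n y hy := by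
  rw [hcls, hcls, hcls, ← ev_add, ← Preadditive.comp_add]
  congr 2
  rw [← cancel_epi (K.pOpcycles n)]
  simp [spn_add]

lemma ev_smul {H : (ModuleCat.{0} A)ᵒᵖ} (z : A) (f : H ⟶ op (ModuleCat.of A A)) :
    ev (f ≫ (ModuleCat.ofHom (z • LinearMap.id : A →ₗ[A] A)).op) = z • ev f := by
  refine Eq.trans ?_ (map_smul f.unop.hom z 1)
  rfl

lemma spn_smul {H : (ModuleCat.{0} A)ᵒᵖ} (z : A) (x : H.unop) :
    spn (z • x) = spn x ≫ (ModuleCat.ofHom (z • LinearMap.id : A →ₗ[A] A)).op := by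
  rw [← spn_ev (spn x ≫ _), ev_smul, ev_spn]

lemma hcls_smul (z : A) (x : (K.X n).unop) (hx) :
    hcls K n (z • x) (by rw [map_smul, hx, smul_zero]) = z • hcls K n x hx := by
  rw [hcls, hcls, ← ev_smul, Category.assoc]
  congr 2
  rw [← cancel_epi (K.pOpcycles n)]
  simp [spn_smul]

lemma hcls_map {K L : ChainComplex (ModuleCat.{0} A)ᵒᵖ ℕ} (g : K ⟶ L) (x : (L.X n).unop) (hx) (hx') :
   (HomologicalComplex.homologyMap g n).unop.hom (hcls L n x hx) = hcls K n ((g.f n).unop.hom x) hx' := by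
  rw [hcls, hcls, ← ev_comp]
  congr 1
  rw [HomologicalComplex.homologyι_naturality_assoc]
  congr 1
  rw [← cancel_epi (K.pOpcycles n)]
  simp [comp_spn]

instance : Injective (op (ModuleCat.of A A)) := by
  have : Projective (ModuleCat.of A A) := inferInstance
  infer_instance

lemma hcls_surj (z : (K.homology n).unop) : ∃ x hx, hcls K n x hx = z := by
  have := Injective.comp_factorThru (spn z) (K.homologyι n)
  set f := Injective.factorThru (spn z) (K.homologyι n)
  have h0 : (K.d (n + 1) n).unop.hom (ev (K.pOpcycles n ≫ f)) = 0 := by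
    rw [← ev_comp]; simp [ev]
  refine ⟨ev (K.pOpcycles n ≫ f), h0, ?_⟩
  rw [hcls]
  conv_rhs => rw [← ev_spn z, ← this]
  congr 2
  rw [← cancel_epi (K.pOpcycles n)]
  simp [spn_ev]

lemma hcls_zero_iff (m : ℕ) (hm : (ComplexShape.down ℕ).next n = m) (x : (K.X n).unop) (hx) :
    hcls K n x hx = 0 ↔ ∃ y : (K.X m).unop, (K.d n m).unop.hom y = x := by
  constructor
  · intro h
    have h1 : K.homologyι n ≫ K.descOpcycles (spn x) (n + 1) (by simp) (by rw [comp_spn, hx, spn_zero]) = 0 := by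
      rw [← spn_ev (_ ≫ _)]
      rw [hcls] at h
      rw [h, spn_zero]
    subst hm
    have hex : (ShortComplex.mk (K.homologyι n) (K.fromOpcycles n ((ComplexShape.down ℕ).next n)) (by simp)).Exact :=
      ShortComplex.exact_of_f_is_kernel _ (K.homologyIsKernel n _ rfl)
    let g := hex.descToInjective _ h1
    have hg : K.fromOpcycles n ((ComplexShape.down ℕ).next n) ≫ g = _ := hex.comp_descToInjective _ h1
    refine ⟨ev g, ?_⟩
    apply spn_inj
    rw [← comp_spn, spn_ev]
    have := congrArg (K.pOpcycles n ≫ ·) hg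
    simpa using this
  · rintro ⟨y, rfl⟩
    have : K.descOpcycles (spn ((K.d n m).unop.hom y)) (n + 1) (by simp) (by rw [comp_spn, hx, spn_zero]) = K.fromOpcycles n m ≫ spn y := by
      rw [← cancel_epi (K.pOpcycles n)]
      rw [K.p_descOpcycles, HomologicalComplex.p_fromOpcycles_assoc, comp_spn]
    rw [hcls, this]
    simp [ev]


noncomputable abbrev hom (M : ModuleCat.{0} A) : ModuleCat.{0} A ⥤ (ModuleCat.{0} A)ᵒᵖ :=
  ((linearYoneda A (ModuleCat.{0} A)).obj M).rightOp

noncomputable abbrev cplx {X : ModuleCat.{0} A} (P : ProjectiveResolution X) (M : ModuleCat.{0} A) :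
    ChainComplex (ModuleCat.{0} A)ᵒᵖ ℕ :=
  ((hom M).mapHomologicalComplex _).obj P.complex

noncomputable abbrev E (n : ℕ) (X M : ModuleCat.{0} A) : ModuleCat.{0} A :=
  ((Ext A (ModuleCat.{0} A) n).obj (op X)).obj M

noncomputable def isoE {X : ModuleCat.{0} A} (P : ProjectiveResolution X) (M : ModuleCat.{0} A) (n : ℕ) :
  op (E n X M) ≅ (cplx P M).homology n := P.isoLeftDerivedObj (hom M) n

section
variable {X : ModuleCat.{0} A} (P : ProjectiveResolution X) {M N : ModuleCat.{0} A} {n : ℕ}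

noncomputable def ecls (φ : P.complex.X n ⟶ M) (h : P.complex.d (n+1) n ≫ φ = 0) : E n X M :=
  (isoE P M n).hom.unop.hom (hcls (cplx P M) n φ h)

lemma isoE_inj : Function.Injective (isoE P M n).hom.unop.hom := by
  intro x y h
  have := congrArg (isoE P M n).inv.unop.hom h
  simpa [← ModuleCat.comp_apply, ← unop_comp] using this

lemma isoE_surj : Function.Surjective (isoE P M n).hom.unop.hom := by
  intro x
  refine ⟨(isoE P M n).inv.unop.hom x, ?_⟩
  simp [← ModuleCat.comp_apply, ← unop_comp]

lemma ecls_surj (z : E n X M) : ∃ φ h, ecls P (n := n) (M := M) φ h = z := by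
  obtain ⟨w, rfl⟩ := isoE_surj P z
  obtain ⟨x, hx, rfl⟩ := hcls_surj _ _ w
  exact ⟨x, hx, rfl⟩

lemma ecls_zero_iff (m : ℕ) (hm : (ComplexShape.down ℕ).next n = m) (φ : P.complex.X n ⟶ M) (h) :
    ecls P φ h = 0 ↔ ∃ ψ : P.complex.X m ⟶ M, P.complex.d n m ≫ ψ = φ := by
  refine Iff.trans ?_ (hcls_zero_iff (cplx P M) n m hm φ h)
  rw [ecls, map_eq_zero_iff _ (isoE_inj P)]

lemma ecls_add (φ ψ : P.complex.X n ⟶ M) (h h') :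
    ecls P (φ + ψ) (by simp [h, h']) = ecls P φ h + ecls P ψ h' :=
  (congrArg _ (hcls_add (cplx P M) n φ ψ h h')).trans (map_add _ _ _)

lemma ecls_smul (z : A) (φ : P.complex.X n ⟶ M) (h) :
    ecls P (z • φ) (by simp [h]) = z • ecls P φ h :=
  (congrArg _ (hcls_smul (cplx P M) n z φ h)).trans (map_smul _ _ _)

lemma ecls_map (φ : P.complex.X n ⟶ M) (h) (f : M ⟶ N) :
    (((Ext A (ModuleCat.{0} A) n).obj (op X)).map f).hom (ecls P φ h) = ecls P (φ ≫ f) (by rw [reassoc_of% h, Limits.zero_comp]) := by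
  have := ProjectiveResolution.leftDerived_app_eq (NatTrans.rightOp ((linearYoneda A (ModuleCat.{0} A)).map f)) P n
  have h2 := congrArg (fun t => t.unop.hom ((isoE P M n).hom.unop.hom (hcls (cplx P M) n φ h))) this
  refine h2.trans ?_
  have h3 := hcls_map n ((NatTrans.mapHomologicalComplex (NatTrans.rightOp ((linearYoneda A (ModuleCat.{0} A)).map f)) _).app P.complex) φ h (by
    exact (congrArg (· ≫ f) h).trans Limits.zero_comp)
  have h4 : (isoE P M n).inv.unop.hom ((isoE P M n).hom.unop.hom (hcls (cplx P M) n φ h)) = hcls (cplx P M) n φ h := by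
    simp [← ModuleCat.comp_apply, ← unop_comp]
  refine Eq.trans ?_ (congrArg (isoE P N n).hom.unop.hom h3)
  conv_rhs => rw [← h4]
  rfl

lemma ecls_map_left {Y : ModuleCat.{0} A} (Q : ProjectiveResolution Y) (f : X ⟶ Y) (g : P.complex ⟶ Q.complex)
     (comm : g.f 0 ≫ Q.π.f 0 = P.π.f 0 ≫ f) (φ : Q.complex.X n ⟶ M) (h) :
    (((Ext A (ModuleCat.{0} A) n).map f.op).app M).hom (ecls Q φ h) = ecls P (g.f n ≫ φ) (by rw [← g.comm_assoc, h, Limits.comp_zero]) := by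
  have := ProjectiveResolution.isoLeftDerivedObj_hom_naturality f P Q g comm (hom M) n
  have h2 := congrArg (fun t => t.unop.hom (hcls (cplx Q M) n φ h)) this
  refine h2.trans ?_
  have h3 := hcls_map n (((hom M).mapHomologicalComplex _).map g) φ h (by
    exact (g.comm_assoc _ _ _).symm.trans ((congrArg (g.f (n+1) ≫ ·) h).trans Limits.comp_zero))
  exact congrArg (isoE P M n).hom.unop.hom h3
end

end

section

variable {A : Type} [CommRing A] (c : Ideal A)
open localCohomology Limits

noncomputable def res (k : ℕ) : ProjectiveResolution (ModuleCat.of A (A ⧸ c ^ k)) := projectiveResolution _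

noncomputable def trans {k l : ℕ} (h : k ≤ l) : ModuleCat.of A (A ⧸ c ^ l) ⟶ ModuleCat.of A (A ⧸ c ^ k) :=
  ModuleCat.ofHom <| Submodule.mapQ _ _ LinearMap.id (Ideal.pow_le_pow_right h)

noncomputable def lam {k l : ℕ} (h : k ≤ l) : (res c l).complex ⟶ (res c k).complex :=
  ProjectiveResolution.lift (trans c h) _ _

lemma lam_comm {k l : ℕ} (h : k ≤ l) :
   (lam c h).f 0 ≫ (res c k).π.f 0 = (res c l).π.f 0 ≫ trans c h := by
  exact ProjectiveResolution.lift_commutes_zero _ _ _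

variable {c} {M N : ModuleCat.{0} A} {n : ℕ}

variable (M c n) in
noncomputable def inc (k : ℕ) : E n (ModuleCat.of A (A ⧸ c ^ k)) M ⟶ (localCohomology c n).obj M :=
  (colimit.ι (diagram (idealPowersDiagram c) n) (op (op k))).app M

lemma inc_map (f : M ⟶ N) (k : ℕ) (x) :
   ((localCohomology c n).map f).hom ((inc c M n k).hom x) =
    (inc c N n k).hom ((((Ext A (ModuleCat.{0} A) n).obj _).map f).hom x) := by
  have := (colimit.ι (diagram (idealPowersDiagram c) n) (op (op k))).naturality f
  exact (congrArg (fun t => t.hom x) this).symm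

lemma inc_up {k l : ℕ} (h : k ≤ l) (x) :
    (inc c M n l).hom ((((Ext A (ModuleCat.{0} A) n).map (trans c h).op).app M).hom x) = (inc c M n k).hom x := by
  have := colimit.w (diagram (idealPowersDiagram c) n) (homOfLE h).op.op
  exact (congrArg (fun t => (t.app M).hom x) this)

noncomputable def evCocone (c : Ideal A) (M : ModuleCat.{0} A) (n : ℕ) :=
  isColimitOfPreserves ((evaluation _ _).obj M) (colimit.isColimit (diagram (idealPowersDiagram c) n))

lemma inc_surj (z : (localCohomology c n).obj M) : ∃ k x, (inc c M n k).hom x = z := by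
  obtain ⟨j, x, h⟩ := Concrete.isColimit_exists_rep _ (evCocone c M n) z
  exact ⟨j.unop.unop, x, h⟩

lemma inc_zero (k : ℕ) (x) (hx : (inc c M n k).hom x = 0) : ∃ (l : ℕ) (h : k ≤ l),
    (((Ext A (ModuleCat.{0} A) n).map (trans c h).op).app M).hom x = 0 := by
  obtain ⟨j, f, g, h⟩ := Concrete.isColimit_exists_of_rep_eq _ (evCocone c M n) (i := op (op k)) (j := op (op k)) x 0 (by
    refine Eq.trans hx ?_
    exact (map_zero (inc c M n k).hom).symm)
  refine ⟨j.unop.unop, leOfHom f.unop.unop, ?_⟩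
  refine h.trans ?_
  exact map_zero (((Ext A (ModuleCat.{0} A) n).map (trans c (leOfHom g.unop.unop)).op).app M).hom

noncomputable abbrev cpx (c : Ideal A) (k n : ℕ) : ModuleCat.{0} A := (res c k).complex.X n

instance (k n : ℕ) : Projective (cpx c k n) := (res c k).projective n

noncomputable abbrev dif (c : Ideal A) (k i j : ℕ) : cpx c k i ⟶ cpx c k j := (res c k).complex.d i j

noncomputable def lcls (k : ℕ) (φ : cpx c k n ⟶ M) (h : dif c k (n+1) n ≫ φ = 0) : (localCohomology c n).obj M :=
  (inc c M n k).hom (ecls (res c k) φ h)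

lemma lam_cocyc {k l : ℕ} (hkl : k ≤ l) {φ : cpx c k n ⟶ M} (h : dif c k (n+1) n ≫ φ = 0) :
    dif c l (n+1) n ≫ (lam c hkl).f n ≫ φ = 0 := by
  rw [← (lam c hkl).comm_assoc, h, comp_zero]

lemma lcls_up {k l : ℕ} (hkl : k ≤ l) {φ : cpx c k n ⟶ M} (h : dif c k (n+1) n ≫ φ = 0) :
    lcls l ((lam c hkl).f n ≫ φ) (lam_cocyc hkl h) = lcls k φ h := by
  rw [lcls, lcls, ← inc_up hkl, ecls_map_left (res c l) (res c k) (trans c hkl) (lam c hkl) (lam_comm c hkl)]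

lemma lcls_surj (z : (localCohomology c n).obj M) : ∃ k φ h, lcls (c := c) k (n := n) φ h = z := by
  obtain ⟨k, x, rfl⟩ := inc_surj z
  obtain ⟨φ, h, rfl⟩ := ecls_surj (res c k) x
  exact ⟨k, φ, h, rfl⟩

lemma lcls_zero {k : ℕ} {φ : cpx c k n ⟶ M} {h : dif c k (n+1) n ≫ φ = 0} (hz : lcls k φ h = 0)
    (m : ℕ) (hm : (ComplexShape.down ℕ).next n = m) :
    ∃ (l : ℕ) (hl : k ≤ l) (ψ : cpx c l m ⟶ M), dif c l n m ≫ ψ = (lam c hl).f n ≫ φ := by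
  obtain ⟨l, hl, h2⟩ := inc_zero _ _ hz
  rw [ecls_map_left (res c l) (res c k) (trans c hl) (lam c hl) (lam_comm c hl), ecls_zero_iff _ m hm] at h2
  exact ⟨l, hl, h2⟩

lemma lcls_bdry {k m : ℕ} (ψ : cpx c k m ⟶ M) (h) (hm : (ComplexShape.down ℕ).next n = m) : lcls k (dif c k n m ≫ ψ) h = 0 := by
  rw [lcls, (ecls_zero_iff (res c k) m hm _ h).2 ⟨ψ, rfl⟩, map_zero]

lemma lcls_add {k : ℕ} (φ ψ : cpx c k n ⟶ M) (h h') :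
    lcls k (φ + ψ) (by simp [h, h']) = lcls k φ h + lcls k ψ h' := by
  rw [lcls, ecls_add _ _ _ h h', map_add]; rfl

lemma lcls_smul {k : ℕ} (z : A) (φ : cpx c k n ⟶ M) (h) :
    lcls k (z • φ) (by simp [h]) = z • lcls k φ h := by
  rw [lcls, ecls_smul _ _ _ h, map_smul]; rfl

lemma lcls_map {k : ℕ} (φ : cpx c k n ⟶ M) (h) (f : M ⟶ N) :
    ((localCohomology c n).map f).hom (lcls k φ h) = lcls k (φ ≫ f) (by rw [reassoc_of% h, Limits.zero_comp]) := by
  rw [lcls, inc_map, ecls_map]; rfl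

end

section

variable {A : Type} [CommRing A] {c : Ideal A}
open Limits

section delta
variable {S : ShortComplex (ModuleCat.{0} A)} (hS : S.ShortExact) {n : ℕ}

lemma lcls_congr {M : ModuleCat.{0} A} {k : ℕ} {φ ψ : cpx c k n ⟶ M} (e : φ = ψ) (h) :
    lcls k φ h = lcls k ψ (e ▸ h) := by subst e; rfl

def deltaRel (c : Ideal A) (S : ShortComplex (ModuleCat.{0} A)) (n : ℕ) (z : (localCohomology c n).obj S.X₃)
    (w : (localCohomology c (n + 1)).obj S.X₁) : Prop :=
  ∃ (k : ℕ) (ψ : cpx c k n ⟶ S.X₂) (χ : cpx c k (n + 1) ⟶ S.X₁) (h₁ : _) (h₂ : _),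
    χ ≫ S.f = dif c k (n + 1) n ≫ ψ ∧ z = lcls k (ψ ≫ S.g) h₁ ∧ w = lcls k χ h₂

lemma deltaRel_raise {k l : ℕ} (hkl : k ≤ l) {ψ : cpx c k n ⟶ S.X₂} {χ : cpx c k (n + 1) ⟶ S.X₁}
    (h : χ ≫ S.f = dif c k (n + 1) n ≫ ψ) :
    ((lam c hkl).f (n + 1) ≫ χ) ≫ S.f = dif c l (n + 1) n ≫ (lam c hkl).f n ≫ ψ := by
  rw [Category.assoc, h, (lam c hkl).comm_assoc]

lemma deltaRel_at {z w} (h : deltaRel c S n z w) : ∃ k₀, ∀ k ≥ k₀,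
    ∃ (ψ : cpx c k n ⟶ S.X₂) (χ : cpx c k (n + 1) ⟶ S.X₁) (h₁ : _) (h₂ : _),
    χ ≫ S.f = dif c k (n + 1) n ≫ ψ ∧ z = lcls k (ψ ≫ S.g) h₁ ∧ w = lcls k χ h₂ := by
  obtain ⟨k, ψ, χ, h₁, h₂, e, rfl, rfl⟩ := h
  refine ⟨k, fun l hl ↦ ⟨(lam c hl).f n ≫ ψ, (lam c hl).f (n + 1) ≫ χ, ?_, ?_, deltaRel_raise hl e, ?_, ?_⟩⟩
  · rw [Category.assoc]; exact lam_cocyc hl h₁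
  · exact lam_cocyc hl h₂
  · rw [← lcls_up hl h₁]; exact lcls_congr (by rw [Category.assoc]) _
  · rw [← lcls_up hl h₂]

lemma deltaRel_add {z w z' w'} (h : deltaRel c S n z w) (h' : deltaRel c S n z' w') :
    deltaRel c S n (z + z') (w + w') := by
  obtain ⟨k₀, h⟩ := deltaRel_at h
  obtain ⟨k₁, h'⟩ := deltaRel_at h'
  obtain ⟨ψ, χ, h₁, h₂, e, rfl, rfl⟩ := h (max k₀ k₁) (le_max_left _ _)
  obtain ⟨ψ', χ', h₁', h₂', e', rfl, rfl⟩ := h' (max k₀ k₁) (le_max_right _ _)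
  refine ⟨max k₀ k₁, ψ + ψ', χ + χ', ?_, ?_, ?_, ?_, ?_⟩
  · rw [Preadditive.add_comp, Preadditive.comp_add, h₁, h₁', add_zero]
  · rw [Preadditive.comp_add, h₂, h₂', add_zero]
  · rw [Preadditive.add_comp, e, e', Preadditive.comp_add]
  · rw [← lcls_add]; exact lcls_congr (by rw [Preadditive.add_comp]) _
  · rw [← lcls_add]

lemma deltaRel_smul {z w} (a : A) (h : deltaRel c S n z w) :
    deltaRel c S n (a • z) (a • w) := by
  obtain ⟨k, ψ, χ, h₁, h₂, e, rfl, rfl⟩ := h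
  refine ⟨k, a • ψ, a • χ, ?_, ?_, ?_, ?_, ?_⟩
  · rw [Linear.smul_comp, Linear.comp_smul, h₁, smul_zero]
  · rw [Linear.comp_smul, h₂, smul_zero]
  · rw [Linear.smul_comp, e, Linear.comp_smul]
  · rw [← lcls_smul]; exact lcls_congr (by rw [Linear.smul_comp]) _
  · rw [← lcls_smul]

include hS

lemma exists_cochain_of_cocycle {k : ℕ} (ψ : cpx c k n ⟶ S.X₂) (h : dif c k (n + 1) n ≫ ψ ≫ S.g = 0) :
    ∃ χ : cpx c k (n + 1) ⟶ S.X₁, χ ≫ S.f = dif c k (n + 1) n ≫ ψ ∧ dif c k (n + 2) (n + 1) ≫ χ = 0 := by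
  have := hS.mono_f
  refine ⟨hS.exact.lift (dif c k (n + 1) n ≫ ψ) (by rw [Category.assoc, h]), hS.exact.lift_f _ _, ?_⟩
  rw [← cancel_mono S.f, Category.assoc, hS.exact.lift_f, zero_comp]
  simp

lemma deltaRel_total (z) : ∃ w, deltaRel c S n z w := by
  obtain ⟨k, φ, h, rfl⟩ := lcls_surj z
  have := hS.epi_g
  let ψ := Projective.factorThru φ S.g
  have hψ : ψ ≫ S.g = φ := Projective.factorThru_comp _ _
  obtain ⟨χ, h1, h2⟩ := exists_cochain_of_cocycle hS ψ (by rw [hψ, h])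
  exact ⟨_, k, ψ, χ, by rw [hψ, h], h2, h1, lcls_congr hψ.symm _, rfl⟩

lemma exists_mid {k : ℕ} (ψ : cpx c k n ⟶ S.X₂) (h) (h0 : lcls k (ψ ≫ S.g) h = 0) :
    ∃ (l : ℕ) (hl : k ≤ l) (θ : cpx c l n ⟶ S.X₁) (ξ : cpx c l ((ComplexShape.down ℕ).next n) ⟶ S.X₂),
      (lam c hl).f n ≫ ψ = θ ≫ S.f + dif c l n _ ≫ ξ := by
  have := hS.epi_g
  have := hS.mono_f
  obtain ⟨l, hl, ψ₁, e⟩ := lcls_zero h0 _ rfl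
  let ξ := Projective.factorThru ψ₁ S.g
  have hξ : ξ ≫ S.g = ψ₁ := Projective.factorThru_comp _ _
  refine ⟨l, hl, hS.exact.lift ((lam c hl).f n ≫ ψ - dif c l n _ ≫ ξ) ?_, ξ, ?_⟩
  · rw [Preadditive.sub_comp, Category.assoc, Category.assoc, hξ, e, sub_self]
  · rw [hS.exact.lift_f]; abel

lemma deltaRel_zero {w} (h : deltaRel c S n 0 w) : w = 0 := by
  have := hS.mono_f
  obtain ⟨k, ψ, χ, h₁, h₂, e, h0, rfl⟩ := h
  obtain ⟨l, hl, θ, ξ, e2⟩ := exists_mid hS ψ h₁ h0.symm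
  rw [← lcls_up hl]
  have : (lam c hl).f (n + 1) ≫ χ = dif c l (n + 1) n ≫ θ := by
    rw [← cancel_mono S.f, deltaRel_raise hl e, e2]
    simp
  rw [lcls_congr this]
  exact lcls_bdry θ _ (by simp)

lemma exact_mid (y : (localCohomology c n).obj S.X₂) (hy : ((localCohomology c n).map S.g).hom y = 0) :
    ∃ x, ((localCohomology c n).map S.f).hom x = y := by
  have := hS.mono_f
  obtain ⟨k, φ, h, rfl⟩ := lcls_surj y
  rw [lcls_map] at hy
  obtain ⟨l, hl, θ, ξ, e2⟩ := exists_mid hS φ _ hy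
  have hθ : dif c l (n + 1) n ≫ θ = 0 := by
    rw [← cancel_mono S.f, Category.assoc, zero_comp]
    have := congrArg (dif c l (n + 1) n ≫ ·) e2
    simpa [h, lam_cocyc hl h] using this.symm
  refine ⟨lcls l θ hθ, ?_⟩
  rw [lcls_map, ← lcls_up hl h, lcls_congr e2, lcls_add (θ ≫ S.f) _ (by rw [reassoc_of% hθ, zero_comp]) (by simp),
    lcls_bdry _ _ rfl, add_zero]

lemma exists_delta : ∃ δ : (localCohomology c n).obj S.X₃ →ₗ[A] (localCohomology c (n + 1)).obj S.X₁,
    Function.Exact ((localCohomology c n).map S.g).hom δ ∧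
    Function.Exact δ ((localCohomology c (n + 1)).map S.f).hom := by
  have hm := hS.mono_f
  choose δ hδ using deltaRel_total hS (c := c) (n := n)
  have huniq : ∀ z w, deltaRel c S n z w → w = δ z := by
    intro z w h
    have h1 := deltaRel_add h (deltaRel_smul (-1) (hδ z))
    have h2 : z + (-1 : A) • z = 0 := by simp
    rw [h2] at h1
    have := deltaRel_zero hS h1
    have h3 : w + (-1 : A) • δ z = w - δ z := by rw [neg_one_smul, sub_eq_add_neg]
    rw [h3] at this
    exact sub_eq_zero.1 this
  refine ⟨⟨⟨δ, fun x y ↦ (huniq _ _ (deltaRel_add (hδ x) (hδ y))).symm⟩,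
    fun a x ↦ (huniq _ _ (deltaRel_smul a (hδ x))).symm⟩, ?_, ?_⟩
  · intro z
    change δ z = 0 ↔ _
    constructor
    · intro h0
      obtain ⟨k, ψ, χ, h₁, h₂, e, rfl, hw⟩ := hδ z
      rw [h0] at hw
      obtain ⟨l, hl, θ, e2⟩ := lcls_zero hw.symm n (by simp)
      have hc : dif c l (n + 1) n ≫ ((lam c hl).f n ≫ ψ - θ ≫ S.f) = 0 := by
        rw [Preadditive.comp_sub, ← deltaRel_raise hl e, ← e2, Category.assoc, sub_self]
      refine ⟨lcls l _ hc, ?_⟩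
      rw [lcls_map, ← lcls_up hl h₁]
      exact lcls_congr (by rw [Preadditive.sub_comp, Category.assoc, Category.assoc, S.zero, comp_zero, sub_zero]) _
    · rintro ⟨y, rfl⟩
      obtain ⟨k, ψ, h, rfl⟩ := lcls_surj y
      refine (huniq _ 0 ⟨k, ψ, 0, by rw [reassoc_of% h, zero_comp], by simp, by simp [h], lcls_map _ _ _, ?_⟩).symm
      have := lcls_smul (k := k) (n := n + 1) (c := c) (0 : A) (0 : cpx c k (n + 1) ⟶ S.X₁) (by simp)
      exact (zero_smul A _).symm.trans (this.symm.trans (lcls_congr (zero_smul _ _) _))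
  · intro w
    change _ ↔ w ∈ Set.range δ
    constructor
    · intro h0
      obtain ⟨k, χ, h, rfl⟩ := lcls_surj w
      rw [lcls_map] at h0
      obtain ⟨l, hl, ψ, e2⟩ := lcls_zero h0 n (by simp)
      refine ⟨lcls l (ψ ≫ S.g) ?_, (huniq _ _ ⟨l, ψ, (lam c hl).f _ ≫ χ, ?_, lam_cocyc hl h, ?_, rfl, ?_⟩).symm⟩
      · rw [reassoc_of% e2]; simp
      · rw [reassoc_of% e2]; simp
      · rw [e2, Category.assoc]
      · rw [lcls_up]
    · rintro ⟨z, rfl⟩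
      obtain ⟨k, ψ, χ, h₁, h₂, e, rfl, hw⟩ := hδ z
      rw [hw, lcls_map, lcls_congr e]
      exact lcls_bdry _ _ (by simp)

end delta

end

section

variable {A : Type} [CommRing A] {c : Ideal A}
open Limits

noncomputable def aug (c : Ideal A) (k : ℕ) : cpx c k 0 ⟶ ModuleCat.of A (A ⧸ c ^ k) := (res c k).π.f 0

lemma aug_surj (k : ℕ) : Function.Surjective (aug c k).hom := by
  have : Epi ((res c k).π.f 0) := inferInstance
  exact (ModuleCat.epi_iff_surjective _).1 this

lemma aug_exact (k : ℕ) : Function.Exact (dif c k 1 0).hom (aug c k).hom := by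
  have := (res c k).exact₀
  rw [ShortComplex.moduleCat_exact_iff_range_eq_ker] at this
  exact LinearMap.exact_iff.2 this.symm

lemma lam_aug {k l : ℕ} (h : k ≤ l) : (lam c h).f 0 ≫ aug c k = aug c l ≫ trans c h := lam_comm c h

noncomputable def gen (c : Ideal A) (k : ℕ) : cpx c k 0 := (aug_surj (c := c) k (Ideal.Quotient.mk _ 1)).choose

lemma aug_gen (k : ℕ) : (aug c k).hom (gen c k) = Ideal.Quotient.mk _ 1 :=
  (aug_surj (c := c) k (Ideal.Quotient.mk _ 1)).choose_spec

variable {M N : ModuleCat.{0} A}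

lemma cocyc_eq {k : ℕ} {φ : cpx c k 0 ⟶ M} (h : dif c k 1 0 ≫ φ = 0) {x y : cpx c k 0}
    (e : (aug c k).hom x = (aug c k).hom y) : φ.hom x = φ.hom y := by
  have h1 : (aug c k).hom (x - y) = 0 := by rw [map_sub, e, sub_self]
  obtain ⟨w, hw⟩ := (aug_exact k _).1 h1
  rw [← sub_eq_zero, ← map_sub, ← hw, ← ModuleCat.comp_apply, h]
  rfl

lemma lam_gen {k l : ℕ} (hkl : k ≤ l) {φ : cpx c k 0 ⟶ M} (h : dif c k 1 0 ≫ φ = 0) :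
    ((lam c hkl).f 0 ≫ φ).hom (gen c l) = φ.hom (gen c k) := by
  rw [ModuleCat.comp_apply]
  refine cocyc_eq h ?_
  rw [← ModuleCat.comp_apply, lam_aug, ModuleCat.comp_apply, aug_gen, aug_gen]
  rfl

lemma lcls_eq_gen {k : ℕ} {φ : cpx c k 0 ⟶ M} {h : dif c k 1 0 ≫ φ = 0} (h0 : lcls k φ h = 0) :
    φ.hom (gen c k) = 0 := by
  obtain ⟨l, hl, ψ, e⟩ := lcls_zero h0 0 (by simp)
  rw [← lam_gen hl h, ← e]
  simp [dif]

lemma lcls_sub {n k : ℕ} (φ ψ : cpx c k n ⟶ M) (h h') :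
    lcls k (φ - ψ) (by simp [h, h']) = lcls k φ h - lcls k ψ h' := by
  rw [eq_sub_iff_add_eq, ← lcls_add]
  exact lcls_congr (sub_add_cancel _ _) _

lemma lcls_gen_eq {k k' : ℕ} {φ : cpx c k 0 ⟶ M} {φ' : cpx c k' 0 ⟶ M} {h h'}
    (e : lcls k φ h = lcls k' φ' h') : φ.hom (gen c k) = φ'.hom (gen c k') := by
  rw [← lam_gen (le_max_left k k') h, ← lam_gen (le_max_right k k') h', ← sub_eq_zero]
  rw [← lcls_up (le_max_left k k') h, ← lcls_up (le_max_right k k') h', ← sub_eq_zero, ← lcls_sub] at e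
  exact lcls_eq_gen e

noncomputable def h0fun (M : ModuleCat.{0} A) (z : (localCohomology c 0).obj M) : M :=
  (lcls_surj z).choose_spec.choose.hom (gen c _)

lemma h0fun_lcls (k : ℕ) (φ : cpx c k 0 ⟶ M) (h) : h0fun M (lcls k φ h) = φ.hom (gen c k) := by
  obtain ⟨h', e⟩ := (lcls_surj (lcls k φ h)).choose_spec.choose_spec
  exact lcls_gen_eq e

lemma lcls_surj₂ {n : ℕ} (z w : (localCohomology c n).obj M) :
    ∃ k φ ψ h h', lcls (c := c) k (n := n) φ h = z ∧ lcls k ψ h' = w := by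
  obtain ⟨k, φ, h, rfl⟩ := lcls_surj z
  obtain ⟨k', ψ, h', rfl⟩ := lcls_surj w
  exact ⟨max k k', _, _, _, _, lcls_up (le_max_left k k') h, lcls_up (le_max_right k k') h'⟩

noncomputable def h0 (M : ModuleCat.{0} A) : (localCohomology c 0).obj M →ₗ[A] M where
  toFun := h0fun M
  map_add' z w := by
    obtain ⟨k, φ, ψ, h, h', rfl, rfl⟩ := lcls_surj₂ z w
    rw [← lcls_add, h0fun_lcls, h0fun_lcls, h0fun_lcls]
    rfl
  map_smul' a z := by
    obtain ⟨k, φ, h, rfl⟩ := lcls_surj z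
    rw [← lcls_smul, h0fun_lcls, h0fun_lcls]
    rfl

lemma h0_lcls (k : ℕ) (φ : cpx c k 0 ⟶ M) (h) : h0 M (lcls k φ h) = φ.hom (gen c k) := h0fun_lcls _ _ _

lemma h0_map (f : M ⟶ N) (z) : h0 N (((localCohomology c 0).map f).hom z) = f.hom (h0 M z) := by
  obtain ⟨k, φ, h, rfl⟩ := lcls_surj z
  rw [lcls_map, h0_lcls, h0_lcls]
  rfl

lemma h0_inj : Function.Injective (h0 (c := c) M) := by
  rw [injective_iff_map_eq_zero]
  intro z hz
  obtain ⟨k, φ, h, rfl⟩ := lcls_surj z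
  rw [h0_lcls] at hz
  have : φ = dif c k 0 0 ≫ 0 := by
    ext x
    obtain ⟨a, ha⟩ := Ideal.Quotient.mk_surjective ((aug c k).hom x)
    have : φ.hom x = φ.hom (a • gen c k) := by
      refine cocyc_eq h ?_
      rw [map_smul, aug_gen, ← ha]
      change _ = Ideal.Quotient.mk _ (a * 1)
      rw [mul_one]
    rw [this, map_smul, hz]
    simp
  rw [lcls_congr this]
  exact lcls_bdry _ _ (by simp)

lemma h0_range (x : M) : x ∈ LinearMap.range (h0 (c := c) M) ↔ ∃ k, ∀ a ∈ c ^ k, a • x = 0 := by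
  constructor
  · rintro ⟨z, rfl⟩
    obtain ⟨k, φ, h, rfl⟩ := lcls_surj z
    refine ⟨k, fun a ha ↦ ?_⟩
    rw [h0_lcls, ← map_smul, cocyc_eq h (y := 0), map_zero]
    rw [map_smul, aug_gen, map_zero]
    change Ideal.Quotient.mk _ (a * 1) = 0
    rwa [mul_one, Ideal.Quotient.eq_zero_iff_mem]
  · rintro ⟨k, hk⟩
    let f : (A ⧸ c ^ k) →ₗ[A] M := Submodule.liftQ _ (LinearMap.toSpanSingleton A M x) (fun a ha ↦ hk a ha)
    refine ⟨lcls k (aug c k ≫ ModuleCat.ofHom f) ?_, ?_⟩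
    · ext x
      have := (aug_exact (c := c) k _).2 ⟨x, rfl⟩
      simp only [ModuleCat.comp_apply, this]
      simp
    · rw [h0_lcls, ModuleCat.comp_apply, aug_gen]
      change (1 : A) • x = x
      rw [one_smul]

lemma lc_injective (n : ℕ) [Injective M] (z : (localCohomology c (n + 1)).obj M) : z = 0 := by
  obtain ⟨k, φ, h, rfl⟩ := lcls_surj z
  have hex := (res c k).complex_exactAt_succ n
  rw [HomologicalComplex.exactAt_iff' _ (n + 2) (n + 1) n (by simp) (by simp)] at hex
  have e := hex.comp_descToInjective φ h
  rw [lcls_congr e.symm]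
  exact lcls_bdry _ _ (by simp)

end

section

variable {A : Type} [CommRing A]

/-- The submodule of elements killed by a power of `c`. -/
def Gam (c : Ideal A) (M : Type) [AddCommGroup M] [Module A M] : Submodule A M where
  carrier := {x | ∃ k, ∀ a ∈ c ^ k, a • x = 0}
  add_mem' := by
    rintro x y ⟨k, hk⟩ ⟨l, hl⟩
    refine ⟨k + l, fun a ha ↦ ?_⟩
    rw [smul_add, hk a (Ideal.pow_le_pow_right (Nat.le_add_right _ _) ha),
      hl a (Ideal.pow_le_pow_right (Nat.le_add_left _ _) ha), add_zero]
  zero_mem' := ⟨0, fun a _ ↦ smul_zero a⟩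
  smul_mem' := by
    rintro b x ⟨k, hk⟩
    exact ⟨k, fun a ha ↦ by rw [smul_comm, hk a ha, smul_zero]⟩

variable {c : Ideal A} {n : ℕ} {M N K : Type} [AddCommGroup M] [Module A M] [AddCommGroup N] [Module A N]
  [AddCommGroup K] [Module A K]

lemma mem_Gam {x : M} : x ∈ Gam c M ↔ ∃ k, ∀ a ∈ c ^ k, a • x = 0 := Iff.rfl

variable (c n) in
noncomputable def lmap (f : M →ₗ[A] N) : TopLC A c n M →ₗ[A] TopLC A c n N :=
  ((localCohomology c n).map (ModuleCat.ofHom f)).hom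

lemma lmap_id : lmap c n (LinearMap.id : M →ₗ[A] M) = LinearMap.id := by
  have : ModuleCat.ofHom (LinearMap.id : M →ₗ[A] M) = 𝟙 _ := rfl
  rw [lmap, this, CategoryTheory.Functor.map_id]; rfl

lemma lmap_comp (f : M →ₗ[A] N) (g : N →ₗ[A] K) : lmap c n (g ∘ₗ f) = lmap c n g ∘ₗ lmap c n f := by
  have : ModuleCat.ofHom (g ∘ₗ f) = ModuleCat.ofHom f ≫ ModuleCat.ofHom g := rfl
  rw [lmap, this, CategoryTheory.Functor.map_comp]; rfl

lemma lmap_smul (a : A) (f : M →ₗ[A] N) : lmap c n (a • f) = a • lmap c n f := by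
  ext z
  obtain ⟨k, φ, h, rfl⟩ := lcls_surj z
  refine (lcls_map _ _ _).trans ?_
  refine Eq.trans ?_ (congrArg (a • ·) (lcls_map φ h (ModuleCat.ofHom f)).symm)
  refine Eq.trans ?_ (lcls_smul a _ _)
  exact lcls_congr (Linear.comp_smul _ _ _ φ a (ModuleCat.ofHom f)) _

lemma lmap_zero : lmap c n (0 : M →ₗ[A] N) = 0 := by
  have := lmap_smul (c := c) (n := n) (0 : A) (0 : M →ₗ[A] N)
  simpa using this

lemma lmap_lsmul (a : A) (z : TopLC A c n M) : lmap c n (LinearMap.lsmul A M a) z = a • z := by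
  have : LinearMap.lsmul A M a = a • LinearMap.id := by ext; simp
  rw [this, lmap_smul, lmap_id]; rfl

lemma subsingleton_of_subsingleton [Subsingleton M] : Subsingleton (TopLC A c n M) := by
  refine subsingleton_of_forall_eq 0 fun z ↦ ?_
  have h : (LinearMap.id : M →ₗ[A] M) = 0 := by ext; exact Subsingleton.elim _ _
  have := LinearMap.congr_fun (lmap_id (c := c) (n := n) (M := M)) z
  rw [h, lmap_zero] at this
  exact this.symm

lemma shortExact {f : M →ₗ[A] N} {g : N →ₗ[A] K} (hf : Function.Injective f) (h : Function.Exact f g)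
    (hg : Function.Surjective g) :
    (ShortComplex.mk (ModuleCat.ofHom f) (ModuleCat.ofHom g) (by ext x; exact h.apply_apply_eq_zero x)).ShortExact :=
  ModuleCat.shortComplex_shortExact _ h hf hg

lemma lmap_exact {f : M →ₗ[A] N} {g : N →ₗ[A] K} (hf : Function.Injective f) (h : Function.Exact f g)
    (hg : Function.Surjective g) : Function.Exact (lmap c n f) (lmap c n g) := by
  refine LinearMap.exact_of_comp_of_mem_range ?_ (fun y hy ↦ exact_mid (shortExact hf h hg) y hy)
  rw [← lmap_comp, h.linearMap_comp_eq_zero, lmap_zero]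

lemma exists_connecting {f : M →ₗ[A] N} {g : N →ₗ[A] K} (hf : Function.Injective f) (h : Function.Exact f g)
    (hg : Function.Surjective g) : ∃ δ : TopLC A c n K →ₗ[A] TopLC A c (n + 1) M,
      Function.Exact (lmap c n g) δ ∧ Function.Exact δ (lmap c (n + 1) f) :=
  exists_delta (shortExact hf h hg)

variable (c M) in
noncomputable def zeroth : TopLC A c 0 M ≃ₗ[A] Gam c M :=
  (LinearEquiv.ofInjective (h0 (c := c) (ModuleCat.of A M)) h0_inj).trans
    (LinearEquiv.ofEq _ _ (by ext x; exact h0_range (M := ModuleCat.of A M) x))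

lemma zeroth_lmap (f : M →ₗ[A] N) (z) : (zeroth c N (lmap c 0 f z) : N) = f (zeroth c M z) :=
  h0_map (ModuleCat.ofHom f) z

lemma subsingleton_of_injective [Module.Injective A M] : Subsingleton (TopLC A c (n + 1) M) := by
  have := (Module.injective_iff_injective_object A M).1 inferInstance
  exact subsingleton_of_forall_eq 0 fun z ↦ lc_injective (M := ModuleCat.of A M) n z

variable (A M) in
lemma exists_injective : ∃ (I : Type) (_ : AddCommGroup I) (_ : Module A I) (_ : Module.Injective A I)
    (f : M →ₗ[A] I), Function.Injective f := by
  let I : ModuleCat.{0} A := Injective.under (ModuleCat.of A M)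
  refine ⟨I, inferInstance, inferInstance, ?_, (Injective.ι (ModuleCat.of A M)).hom,
    (ModuleCat.mono_iff_injective _).1 inferInstance⟩
  exact (Module.injective_iff_injective_object A I).2 (Injective.injective_under (ModuleCat.of A M))

/-- Dimension shift in positive degrees. -/
lemma shift_succ {f : M →ₗ[A] N} {g : N →ₗ[A] K} (hf : Function.Injective f) (h : Function.Exact f g)
    (hg : Function.Surjective g) [Subsingleton (TopLC A c (n + 1) N)] [Subsingleton (TopLC A c (n + 2) N)] :
    Nonempty (TopLC A c (n + 1) K ≃ₗ[A] TopLC A c (n + 2) M) := by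
  obtain ⟨δ, h1, h2⟩ := exists_connecting (c := c) (n := n + 1) hf h hg
  refine ⟨LinearEquiv.ofBijective δ ⟨?_, fun x ↦ (h2 x).1 (Subsingleton.elim _ _)⟩⟩
  rw [injective_iff_map_eq_zero]
  intro x hx
  obtain ⟨y, rfl⟩ := (h1 x).1 hx
  rw [Subsingleton.elim y 0, map_zero]

/-- The map induced on torsion submodules. -/
def gmap (c : Ideal A) (f : M →ₗ[A] N) : Gam c M →ₗ[A] Gam c N :=
  f.restrict fun _ ⟨k, hk⟩ ↦ ⟨k, fun a ha ↦ by rw [← map_smul, hk a ha, map_zero]⟩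

/-- Dimension shift in degree one. -/
lemma shift_one {f : M →ₗ[A] N} {g : N →ₗ[A] K} (hf : Function.Injective f) (h : Function.Exact f g)
    (hg : Function.Surjective g) [Subsingleton (TopLC A c 1 N)] :
    Nonempty ((Gam c K ⧸ LinearMap.range (gmap c g)) ≃ₗ[A] TopLC A c 1 M) := by
  obtain ⟨δ, h1, h2⟩ := exists_connecting (c := c) (n := 0) hf h hg
  let δ' := δ ∘ₗ (zeroth c K).symm.toLinearMap
  have hs : Function.Surjective δ' := by
    rw [LinearMap.coe_comp]
    exact Function.Surjective.comp (fun x ↦ (h2 x).1 (Subsingleton.elim _ _)) (zeroth c K).symm.surjective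
  have hk : LinearMap.range (gmap c g) = LinearMap.ker δ' := by
    ext x
    rw [LinearMap.mem_ker, LinearMap.comp_apply]
    refine Iff.trans ?_ (h1 _).symm
    constructor
    · rintro ⟨y, rfl⟩
      refine ⟨(zeroth c N).symm y, ?_⟩
      apply (zeroth c K).injective
      ext
      rw [zeroth_lmap]
      simp [gmap]
    · rintro ⟨y, hy⟩
      refine ⟨zeroth c N y, ?_⟩
      ext
      change g _ = _
      refine (zeroth_lmap g y).symm.trans ?_
      rw [hy]
      simp
  exact ⟨(Submodule.quotEquivOfEq _ _ hk).trans (δ'.quotKerEquivOfSurjective hs)⟩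

end

section

variable {A : Type} [CommRing A]

/-- `M` is `a`-power torsion. -/
def IsTors (a : Ideal A) (M : Type) [AddCommGroup M] [Module A M] : Prop :=
  ∀ x : M, ∃ k, ∀ b ∈ a ^ k, b • x = 0

section
variable {a c : Ideal A} {M N : Type} [AddCommGroup M] [Module A M] [AddCommGroup N] [Module A N]

lemma IsTors.of_surjective (h : IsTors a M) (f : M →ₗ[A] N) (hf : Function.Surjective f) : IsTors a N := by
  intro y
  obtain ⟨x, rfl⟩ := hf y
  obtain ⟨k, hk⟩ := h x
  exact ⟨k, fun b hb ↦ by rw [← map_smul, hk b hb, map_zero]⟩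

lemma IsTors.of_injective (h : IsTors a N) (f : M →ₗ[A] N) (hf : Function.Injective f) : IsTors a M := by
  intro x
  obtain ⟨k, hk⟩ := h (f x)
  exact ⟨k, fun b hb ↦ hf (by rw [map_smul, hk b hb, map_zero])⟩

lemma isTors_Gam : IsTors a (Gam a M) := fun ⟨_, k, hk⟩ ↦ ⟨k, fun b hb ↦ Subtype.ext (hk b hb)⟩

variable [IsNoetherianRing A]

instance Gam_injective (E : Type) [AddCommGroup E] [Module A E] [Module.Injective A E] :
    Module.Injective A (Gam a E) := by
  apply Module.Baer.injective
  intro I g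
  obtain ⟨s, hs⟩ : I.FG := IsNoetherian.noetherian I
  have hk : ∃ k, ∀ x : I, ∀ b ∈ a ^ k, b • g x = 0 := by
    have : Module.Finite A I := inferInstance
    obtain ⟨t, ht⟩ := this.fg_top
    choose! e he using (fun x : I ↦ (g x).2)
    refine ⟨t.sup e, fun x b hb ↦ ?_⟩
    have hx : x ∈ Submodule.span A (t : Set I) := ht ▸ Submodule.mem_top
    induction hx using Submodule.span_induction with
    | mem x h => exact Subtype.ext (he x b (Ideal.pow_le_pow_right (Finset.le_sup h) hb))
    | zero => simp
    | add x y _ _ h1 h2 => rw [map_add, smul_add, h1, h2, add_zero]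
    | smul r x _ h => rw [map_smul, smul_comm, h, smul_zero]
  obtain ⟨k, hk⟩ := hk
  obtain ⟨m, hm⟩ := Ideal.exists_pow_inf_eq_pow_smul a (I : Submodule A A)
  have hm := hm (m + k) (by omega)
  rw [Nat.add_sub_cancel_left] at hm
  let q : I →ₗ[A] A ⧸ a ^ (m + k) := (Submodule.mkQ _) ∘ₗ I.subtype
  have hq : LinearMap.ker q ≤ LinearMap.ker ((Gam a E).subtype ∘ₗ g) := by
    intro x hx
    have hx' : (x : A) ∈ a ^ (m + k) := (Submodule.Quotient.mk_eq_zero _).1 hx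
    have h1 : (x : A) ∈ a ^ k • (a ^ m • ⊤ ⊓ I : Submodule A A) := by
      rw [← hm]
      exact ⟨by simpa using hx', x.2⟩
    have h2 : ∀ y ∈ a ^ k • (a ^ m • ⊤ ⊓ I : Submodule A A), ∃ hy : y ∈ I, g ⟨y, hy⟩ = 0 := by
      intro y hy
      refine Submodule.smul_induction_on hy ?_ ?_
      · intro r hr z hz
        refine ⟨I.mul_mem_left r hz.2, ?_⟩
        have : (⟨r • z, I.mul_mem_left r hz.2⟩ : I) = r • ⟨z, hz.2⟩ := rfl
        rw [this, map_smul, hk _ r hr]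
      · rintro y z ⟨hy, hy'⟩ ⟨hz, hz'⟩
        refine ⟨I.add_mem hy hz, ?_⟩
        have : (⟨y + z, I.add_mem hy hz⟩ : I) = ⟨y, hy⟩ + ⟨z, hz⟩ := rfl
        rw [this, map_add, hy', hz', add_zero]
    obtain ⟨_, h3⟩ := h2 _ h1
    rw [LinearMap.mem_ker, LinearMap.comp_apply, h3, map_zero]
  obtain ⟨h, hh⟩ := Module.Injective.out ((LinearMap.ker q).liftQ q le_rfl)
    (by rw [← LinearMap.ker_eq_bot]; exact Submodule.ker_liftQ_eq_bot _ _ _ le_rfl)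
    ((LinearMap.ker q).liftQ ((Gam a E).subtype ∘ₗ g) hq)
  refine ⟨LinearMap.codRestrict _ (h ∘ₗ Submodule.mkQ _) ?_, ?_⟩
  · intro y
    refine ⟨m + k, fun b hb ↦ ?_⟩
    rw [← map_smul, LinearMap.comp_apply]
    have : (a ^ (m + k)).mkQ (b • y) = 0 := (Submodule.Quotient.mk_eq_zero _).2 ((a ^ (m + k)).mul_mem_right y hb)
    rw [this, map_zero]
  · intro x hx
    ext
    exact hh (Submodule.Quotient.mk ⟨x, hx⟩)

lemma IsTors.exists_injective (h : IsTors a M) : ∃ (I : Type) (_ : AddCommGroup I) (_ : Module A I)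
    (_ : Module.Injective A I) (f : M →ₗ[A] I), IsTors a I ∧ Function.Injective f := by
  obtain ⟨E, _, _, _, f, hf⟩ := LC.exists_injective A M
  refine ⟨Gam a E, inferInstance, inferInstance, inferInstance, f.codRestrict _ ?_, isTors_Gam, ?_⟩
  · intro x
    obtain ⟨k, hk⟩ := h x
    exact ⟨k, fun b hb ↦ by rw [← map_smul, hk b hb, map_zero]⟩
  · intro x y hxy
    exact hf (congrArg Subtype.val hxy)

end

variable [IsNoetherianRing A] (a c : Ideal A)

lemma IsTors.subsingleton (n : ℕ) : ∀ (M : Type) [AddCommGroup M] [Module A M], IsTors c M →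
    Subsingleton (TopLC A c (n + 1) M) := by
  induction n with
  | zero =>
    intro M _ _ h
    obtain ⟨I, _, _, _, f, hI, hf⟩ := h.exists_injective
    have := subsingleton_of_injective (c := c) (n := 0) (M := I)
    obtain ⟨e⟩ := shift_one (c := c) hf (LinearMap.exact_map_mkQ_range f) (Submodule.mkQ_surjective _)
    refine e.symm.toEquiv.subsingleton_congr.2 ?_
    rw [Submodule.Quotient.subsingleton_iff, LinearMap.range_eq_top]
    rintro ⟨x, hx⟩
    obtain ⟨y, rfl⟩ := Submodule.mkQ_surjective _ x
    exact ⟨⟨y, hI y⟩, rfl⟩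
  | succ n ih =>
    intro M _ _ h
    obtain ⟨I, _, _, _, f, hI, hf⟩ := h.exists_injective
    have := subsingleton_of_injective (c := c) (n := n) (M := I)
    have := subsingleton_of_injective (c := c) (n := n + 1) (M := I)
    obtain ⟨e⟩ := shift_succ (c := c) (n := n) hf (LinearMap.exact_map_mkQ_range f) (Submodule.mkQ_surjective _)
    exact e.symm.toEquiv.subsingleton_congr.2 (ih _ (hI.of_surjective _ (Submodule.mkQ_surjective _)))

lemma IsTors.topLC (n : ℕ) : ∀ (M : Type) [AddCommGroup M] [Module A M], IsTors a M →
    IsTors a (TopLC A c n M) := by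
  induction n with
  | zero =>
    intro M _ _ h
    exact (h.of_injective _ (Gam c M).subtype_injective).of_injective _ (zeroth c M).injective
  | succ n ih =>
    intro M _ _ h
    obtain ⟨I, _, _, _, f, hI, hf⟩ := h.exists_injective
    have := subsingleton_of_injective (c := c) (n := n) (M := I)
    obtain ⟨δ, h1, h2⟩ := exists_connecting (c := c) (n := n) hf (LinearMap.exact_map_mkQ_range f) (Submodule.mkQ_surjective _)
    exact (ih _ (hI.of_surjective _ (Submodule.mkQ_surjective _))).of_surjective δ fun x ↦ (h2 x).1 (Subsingleton.elim _ _)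

omit [IsNoetherianRing A] in
lemma isTors_topLC (n : ℕ) : ∀ (M : Type) [AddCommGroup M] [Module A M], IsTors c (TopLC A c n M) := by
  induction n with
  | zero =>
    intro M _ _
    exact isTors_Gam.of_injective _ (zeroth c M).injective
  | succ n ih =>
    intro M _ _
    obtain ⟨I, _, _, _, f, hf⟩ := exists_injective A M
    have := subsingleton_of_injective (c := c) (n := n) (M := I)
    obtain ⟨δ, h1, h2⟩ := exists_connecting (c := c) (n := n) hf (LinearMap.exact_map_mkQ_range f) (Submodule.mkQ_surjective _)
    exact (ih _).of_surjective δ fun x ↦ (h2 x).1 (Subsingleton.elim _ _)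

lemma IsTors.topLC_equiv {c₁ c₂ : Ideal A} (H : ∀ (M : Type) [AddCommGroup M] [Module A M], IsTors a M →
    Gam c₁ M = Gam c₂ M) (n : ℕ) : ∀ (M : Type) [AddCommGroup M] [Module A M], IsTors a M →
    Nonempty (TopLC A c₁ n M ≃ₗ[A] TopLC A c₂ n M) := by
  induction n with
  | zero => exact fun M _ _ h ↦ ⟨(zeroth c₁ M).trans ((LinearEquiv.ofEq _ _ (H M h)).trans (zeroth c₂ M).symm)⟩
  | succ n ih =>
    intro M _ _ h
    obtain ⟨I, _, _, _, f, hI, hf⟩ := h.exists_injective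
    have hK := hI.of_surjective _ (Submodule.mkQ_surjective (LinearMap.range f))
    have : ∀ n (c : Ideal A), Subsingleton (TopLC A c (n + 1) I) := fun n c ↦ subsingleton_of_injective
    cases n with
    | zero =>
      obtain ⟨e₁⟩ := shift_one (c := c₁) hf (LinearMap.exact_map_mkQ_range f) (Submodule.mkQ_surjective _)
      obtain ⟨e₂⟩ := shift_one (c := c₂) hf (LinearMap.exact_map_mkQ_range f) (Submodule.mkQ_surjective _)
      suffices h : _ from ⟨e₁.symm.trans ((Submodule.Quotient.equiv _ _ (LinearEquiv.ofEq _ _ (H _ hK)) h).trans e₂)⟩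
      ext ⟨x, hx⟩
      simp only [Submodule.mem_map, LinearMap.mem_range]
      constructor
      · rintro ⟨_, ⟨⟨y, hy⟩, rfl⟩, h⟩
        exact ⟨⟨y, H _ hI ▸ hy⟩, Subtype.ext (congrArg Subtype.val h)⟩
      · rintro ⟨⟨y, hy⟩, h⟩
        exact ⟨_, ⟨⟨y, H _ hI ▸ hy⟩, rfl⟩, Subtype.ext (congrArg Subtype.val h)⟩
    | succ n =>
      obtain ⟨e₁⟩ := shift_succ (c := c₁) (n := n) hf (LinearMap.exact_map_mkQ_range f) (Submodule.mkQ_surjective _)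
      obtain ⟨e₂⟩ := shift_succ (c := c₂) (n := n) hf (LinearMap.exact_map_mkQ_range f) (Submodule.mkQ_surjective _)
      obtain ⟨e⟩ := ih _ hK
      exact ⟨e₁.symm.trans (e.trans e₂)⟩

end

section

variable {A : Type} [CommRing A]

lemma prime_filtration [IsNoetherianRing A]
    {pr : (N : Type) → [AddCommGroup N] → [Module A N] → Prop}
    (h0 : ∀ (N : Type) [AddCommGroup N] [Module A N], Subsingleton N → pr N)
    (hex : ∀ (N₁ N₂ N₃ : Type) [AddCommGroup N₁] [Module A N₁] [AddCommGroup N₂] [Module A N₂]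
      [AddCommGroup N₃] [Module A N₃] (f : N₁ →ₗ[A] N₂) (g : N₂ →ₗ[A] N₃), Function.Injective f →
      Function.Exact f g → Function.Surjective g → pr N₁ → pr N₃ → pr N₂)
    (N : Type) [AddCommGroup N] [Module A N] [hN : Module.Finite A N]
    (hq : ∀ p ∈ Module.support A N, pr (A ⧸ p.asIdeal)) : pr N := by
  revert hq
  induction hN using IsNoetherianRing.induction_on_isQuotientEquivQuotientPrime A with
  | subsingleton N => exact fun _ ↦ h0 N inferInstance
  | quotient N p e =>
    intro hq
    refine hex (A ⧸ p.asIdeal) N PUnit e.symm 0 e.symm.injective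
      ((e.symm.toLinearMap.exact_zero_iff_surjective _).2 e.symm.surjective)
      (Function.surjective_to_subsingleton _) (hq p ?_) (h0 _ inferInstance)
    refine Module.support_subset_of_injective _ e.symm.injective ?_
    rw [Module.support_eq_zeroLocus, Ideal.annihilator_quotient]
    exact le_refl (p.asIdeal : Set A)
  | exact N₁ N₂ N₃ f g hf hg h h₁ h₃ =>
    exact fun hq ↦ hex N₁ N₂ N₃ f g hf h hg (h₁ fun p hp ↦ hq p (Module.support_subset_of_injective f hf hp))
      (h₃ fun p hp ↦ hq p (Module.support_subset_of_surjective g hg hp))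

/-- `A / (q + (z))`, written as a cokernel. -/
abbrev Cok (q : PrimeSpectrum A) (z : A) : Type :=
  (A ⧸ q.asIdeal) ⧸ LinearMap.range (LinearMap.lsmul A (A ⧸ q.asIdeal) z)

variable {q : PrimeSpectrum A} {z : A}

lemma mul_injective (hz : z ∉ q.asIdeal) : Function.Injective (LinearMap.lsmul A (A ⧸ q.asIdeal) z) := by
  rw [injective_iff_map_eq_zero]
  intro x hx
  obtain ⟨x, rfl⟩ := Ideal.Quotient.mk_surjective x
  have : Ideal.Quotient.mk q.asIdeal (z * x) = 0 := hx
  rw [Ideal.Quotient.eq_zero_iff_mem] at this ⊢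
  exact (q.2.mem_or_mem this).resolve_left hz

lemma mul_exact : Function.Exact (LinearMap.lsmul A (A ⧸ q.asIdeal) z)
    (LinearMap.range (LinearMap.lsmul A (A ⧸ q.asIdeal) z)).mkQ := LinearMap.exact_map_mkQ_range _

lemma smul_cok (a : A) (ha : a ∈ q.asIdeal ⊔ Ideal.span {z}) (x : Cok q z) : a • x = 0 := by
  obtain ⟨b, hb, c, hc, rfl⟩ := Submodule.mem_sup.1 ha
  obtain ⟨e, rfl⟩ := Ideal.mem_span_singleton'.1 hc
  obtain ⟨x, rfl⟩ := Submodule.mkQ_surjective _ x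
  have : b • x = 0 := by
    obtain ⟨x, rfl⟩ := Ideal.Quotient.mk_surjective x
    exact Ideal.Quotient.eq_zero_iff_mem.2 (q.asIdeal.mul_mem_right x hb)
  rw [← map_smul, add_smul, this, zero_add]
  exact (Submodule.Quotient.mk_eq_zero _).2 ⟨e • x, by simp [mul_smul]⟩

lemma le_of_mem_support_cok {p : PrimeSpectrum A} (hp : p ∈ Module.support A (Cok q z)) :
    q.asIdeal ⊔ Ideal.span {z} ≤ p.asIdeal :=
  le_trans (fun a ha ↦ Module.mem_annihilator.2 (smul_cok a ha)) (Module.annihilator_le_of_mem_support hp)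

lemma lt_of_mem_support_cok (hz : z ∉ q.asIdeal) {p : PrimeSpectrum A} (hp : p ∈ Module.support A (Cok q z)) :
    q < p := by
  have := le_of_mem_support_cok hp
  refine lt_of_le_of_ne (le_sup_left.trans this) ?_
  rintro rfl
  exact hz (this (Ideal.mem_sup_right (Ideal.mem_span_singleton_self z)))

lemma coheight_lt_of_lt {p q : PrimeSpectrum A} (h : q < p) {n : ℕ} (hn : Order.coheight q ≤ n) :
    ∃ m < n, Order.coheight p ≤ (m : ℕ) := by
  have h1 : Order.coheight p < n := Order.coheight_le_coe_iff.1 hn p h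
  lift Order.coheight p to ℕ using (h1.trans_le le_top).ne with m
  exact ⟨m, by exact_mod_cast h1, le_rfl⟩

variable (c : Ideal A) [IsNoetherianRing A]

omit [IsNoetherianRing A] in
lemma subsingleton_of_exact {X Y Z : Type} [AddCommGroup X] [AddCommGroup Y] [AddCommGroup Z]
    [Module A X] [Module A Y] [Module A Z] {f : X →ₗ[A] Y} {g : Y →ₗ[A] Z} (h : Function.Exact f g)
    (hX : Subsingleton X) (hZ : Subsingleton Z) : Subsingleton Y := by
  refine subsingleton_of_forall_eq 0 fun y ↦ ?_
  obtain ⟨x, rfl⟩ := (h y).1 (Subsingleton.elim _ _)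
  rw [Subsingleton.elim x 0, map_zero]

lemma vanish_of_primes (i : ℕ) (N : Type) [AddCommGroup N] [Module A N] [Module.Finite A N]
    (hq : ∀ p ∈ Module.support A N, Subsingleton (TopLC A c i (A ⧸ p.asIdeal))) :
    Subsingleton (TopLC A c i N) :=
  prime_filtration (pr := fun N ↦ Subsingleton (TopLC A c i N)) (fun _ _ _ _ ↦ subsingleton_of_subsingleton)
    (fun _ _ _ _ _ _ _ _ _ _ _ hf h hg h1 h3 ↦ subsingleton_of_exact (lmap_exact hf h hg) h1 h3) N hq

lemma topLC_quotient_of_le {i : ℕ} (h : c ≤ q.asIdeal) : Subsingleton (TopLC A c (i + 1) (A ⧸ q.asIdeal)) := by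
  refine IsTors.subsingleton _ _ _ fun x ↦ ⟨1, fun b hb ↦ ?_⟩
  obtain ⟨x, rfl⟩ := Ideal.Quotient.mk_surjective x
  exact Ideal.Quotient.eq_zero_iff_mem.2 (q.asIdeal.mul_mem_right x (h (by simpa using hb)))

omit [IsNoetherianRing A] in
lemma smul_injective_of_cok {i : ℕ} (hz : z ∉ q.asIdeal) (h : Subsingleton (TopLC A c i (Cok q z)))
    (x : TopLC A c (i + 1) (A ⧸ q.asIdeal)) (hx : z • x = 0) : x = 0 := by
  obtain ⟨δ, h1, h2⟩ := exists_connecting (c := c) (n := i) (mul_injective hz) mul_exact (Submodule.mkQ_surjective _)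
  rw [← lmap_lsmul] at hx
  obtain ⟨y, rfl⟩ := (h2 x).1 hx
  rw [Subsingleton.elim y 0, map_zero]

omit [IsNoetherianRing A] in
lemma smul_surjective_of_cok {i : ℕ} (hz : z ∉ q.asIdeal) (h : Subsingleton (TopLC A c i (Cok q z)))
    (x : TopLC A c i (A ⧸ q.asIdeal)) : ∃ y, z • y = x := by
  obtain ⟨y, hy⟩ := (lmap_exact (c := c) (n := i) (mul_injective hz) mul_exact (Submodule.mkQ_surjective _) x).1
    (Subsingleton.elim _ _)
  exact ⟨y, by rw [← lmap_lsmul, hy]⟩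

/-- Grothendieck vanishing for `A / q`. -/
theorem grothendieck (n : ℕ) : ∀ q : PrimeSpectrum A, Order.coheight q ≤ n → ∀ i > n,
    Subsingleton (TopLC A c i (A ⧸ q.asIdeal)) := by
  induction n using Nat.strong_induction_on with
  | _ n ih =>
    intro q hq i hi
    obtain ⟨j, rfl⟩ : ∃ j, i = j + 1 := ⟨i - 1, by omega⟩
    by_cases hc : c ≤ q.asIdeal
    · exact topLC_quotient_of_le c hc
    obtain ⟨z, hzc, hz⟩ := SetLike.not_le_iff_exists.1 hc
    have h := vanish_of_primes c j (Cok q z) fun p hp ↦ by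
      obtain ⟨m, hm, hp'⟩ := coheight_lt_of_lt (lt_of_mem_support_cok hz hp) hq
      exact ih m hm p hp' j (by omega)
    refine subsingleton_of_forall_eq 0 fun x ↦ ?_
    obtain ⟨k, hk⟩ := isTors_topLC c _ _ x
    have key : ∀ k, z ^ k • x = 0 → x = 0 := fun k ↦ by
      induction k with
      | zero => simp
      | succ k ihk => exact fun hk ↦ ihk (smul_injective_of_cok c hz h _ (by rwa [smul_smul, ← pow_succ']))
    exact key k (hk _ (Ideal.pow_mem_pow hzc k))

lemma grothendieck_cok {n : ℕ} (hz : z ∉ q.asIdeal) (hq : Order.coheight q ≤ n) {i : ℕ} (hi : n ≤ i) :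
    Subsingleton (TopLC A c i (Cok q z)) :=
  vanish_of_primes c i (Cok q z) fun p hp ↦ by
    obtain ⟨m, hm, hp'⟩ := coheight_lt_of_lt (lt_of_mem_support_cok hz hp) hq
    exact grothendieck c m p hp' i (by omega)

end

section

variable {A : Type} [CommRing A]

/-- The localization `N_y`, as an `A`-module. -/
abbrev Loc (y : A) (N : Type) [AddCommGroup N] [Module A N] : Type :=
  LocalizedModule (Submonoid.powers y) N

section
variable (y : A) {M N K : Type} [AddCommGroup M] [Module A M] [AddCommGroup N] [Module A N]
  [AddCommGroup K] [Module A K]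

/-- `N → N_y`. -/
noncomputable abbrev toLoc (N : Type) [AddCommGroup N] [Module A N] : N →ₗ[A] Loc y N :=
  LocalizedModule.mkLinearMap (Submonoid.powers y) N

/-- Functoriality of `N ↦ N_y`. -/
noncomputable abbrev locMap (f : M →ₗ[A] N) : Loc y M →ₗ[A] Loc y N :=
  IsLocalizedModule.map (Submonoid.powers y) (toLoc y M) (toLoc y N) f

lemma locMap_lsmul (z : A) : locMap y (LinearMap.lsmul A M z) = LinearMap.lsmul A (Loc y M) z := by
  apply IsLocalizedModule.ext (Submonoid.powers y) (toLoc y M) (IsLocalizedModule.map_units (toLoc y M))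
  ext x
  simp only [LinearMap.comp_apply, locMap, IsLocalizedModule.map_apply, LinearMap.lsmul_apply, map_smul]

variable {y} in
lemma exists_pow_smul (x : Loc y M) : ∃ k m, y ^ k • x = toLoc y M m := by
  obtain ⟨⟨m, ⟨_, k, rfl⟩⟩, h⟩ := IsLocalizedModule.surj (Submonoid.powers y) (toLoc y M) x
  exact ⟨k, m, h⟩

variable {y} in
lemma toLoc_eq_zero {m : M} (h : toLoc y M m = 0) : ∃ k, y ^ k • m = 0 := by
  obtain ⟨⟨_, k, rfl⟩, h⟩ := (IsLocalizedModule.eq_zero_iff (Submonoid.powers y) (toLoc y M)).1 h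
  exact ⟨k, h⟩

lemma loc_smul_cancel {k : ℕ} {x : Loc y M} (h : y ^ k • x = 0) : x = 0 := by
  have := IsLocalizedModule.smul_injective (toLoc y M) (⟨y ^ k, k, rfl⟩ : Submonoid.powers y)
  exact this (by simpa only [Submonoid.smul_def, smul_zero] using h)

lemma loc_smul_eq_zero {a : A} (h : ∀ m : M, a • m = 0) (x : Loc y M) : a • x = 0 := by
  obtain ⟨k, m, hm⟩ := exists_pow_smul x
  apply loc_smul_cancel y (k := k)
  rw [smul_comm, hm, ← map_smul, h, map_zero]

lemma isTors_span_iff {x : M} {k : ℕ} : (∀ b ∈ Ideal.span {y} ^ k, b • x = 0) ↔ y ^ k • x = 0 := by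
  rw [Ideal.span_singleton_pow]
  refine ⟨fun h ↦ h _ (Ideal.mem_span_singleton_self _), fun h b hb ↦ ?_⟩
  obtain ⟨e, rfl⟩ := Ideal.mem_span_singleton'.1 hb
  rw [mul_smul, h, smul_zero]

lemma isTors_loc_cokernel : IsTors (Ideal.span {y}) (Loc y M ⧸ LinearMap.range (toLoc y M)) := by
  intro x
  obtain ⟨x, rfl⟩ := Submodule.mkQ_surjective _ x
  obtain ⟨k, m, hm⟩ := exists_pow_smul x
  refine ⟨k, (isTors_span_iff y).2 ?_⟩
  rw [← map_smul, hm]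
  exact (Submodule.Quotient.mk_eq_zero _).2 ⟨m, rfl⟩

end

lemma isTors_of_forall_span {J : Ideal A} (hJ : J.FG) {M : Type} [AddCommGroup M] [Module A M]
    (h : ∀ y ∈ J, IsTors (Ideal.span {y}) M) : IsTors J M := by
  intro x
  obtain ⟨k, hk⟩ := Ideal.exists_pow_le_of_le_radical_of_fg (I := J) (J := Ideal.torsionOf A M x)
    (fun y hy ↦ by
      obtain ⟨k, hk⟩ := h y hy x
      exact ⟨k, (isTors_span_iff y).1 hk⟩) hJ
  exact ⟨k, fun b hb ↦ hk hb⟩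

variable (c : Ideal A) [IsNoetherianRing A]

lemma topLC_loc (y : A) (hy : y ∈ Ideal.jacobson (⊥ : Ideal A)) (n : ℕ) : ∀ q : PrimeSpectrum A,
    y ∉ q.asIdeal → Order.coheight q ≤ n → ∀ i ≥ n,
    Subsingleton (TopLC A c i (Loc y (A ⧸ q.asIdeal))) := by
  induction n using Nat.strong_induction_on with
  | _ n ih =>
    intro q hyq hq i hi
    have hn : n ≠ 0 := by
      rintro rfl
      have h1 : q.asIdeal.IsMaximal := by
        rw [← PrimeSpectrum.isMax_iff, ← Order.coheight_eq_zero]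
        simpa using hq
      exact hyq (Ideal.mem_sInf.1 hy ⟨bot_le, h1⟩)
    obtain ⟨j, rfl⟩ : ∃ j, i = j + 1 := ⟨i - 1, by omega⟩
    by_cases hc : c ≤ q.asIdeal
    · refine IsTors.subsingleton _ _ _ fun x ↦ ⟨1, fun b hb ↦ loc_smul_eq_zero y (fun x ↦ ?_) x⟩
      obtain ⟨x, rfl⟩ := Ideal.Quotient.mk_surjective x
      exact Ideal.Quotient.eq_zero_iff_mem.2 (q.asIdeal.mul_mem_right x (hc (by simpa using hb)))
    obtain ⟨z, hzc, hz⟩ := SetLike.not_le_iff_exists.1 hc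
    have h : Subsingleton (TopLC A c j (Loc y (Cok q z))) := by
      refine prime_filtration (A := A) (pr := fun N ↦ Subsingleton (TopLC A c j (Loc y N))) ?_ ?_ _ ?_
      · exact fun _ _ _ _ ↦ subsingleton_of_subsingleton
      · intro N₁ N₂ N₃ _ _ _ _ _ _ f g hf h hg h1 h3
        exact subsingleton_of_exact (lmap_exact (IsLocalizedModule.map_injective (Submonoid.powers y) (toLoc y N₁) (toLoc y N₂) f hf)
          (IsLocalizedModule.map_exact (Submonoid.powers y) (toLoc y N₁) (toLoc y N₂) (toLoc y N₃) f g h)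
          (IsLocalizedModule.map_surjective (Submonoid.powers y) (toLoc y N₂) (toLoc y N₃) g hg)) h1 h3
      · intro p hp
        by_cases hyp : y ∈ p.asIdeal
        · have : Subsingleton (Loc y (A ⧸ p.asIdeal)) := by
            refine subsingleton_of_forall_eq 0 fun x ↦ ?_
            apply loc_smul_cancel y (k := 1)
            rw [pow_one]
            refine loc_smul_eq_zero y (fun x ↦ ?_) x
            obtain ⟨x, rfl⟩ := Ideal.Quotient.mk_surjective x
            exact Ideal.Quotient.eq_zero_iff_mem.2 (p.asIdeal.mul_mem_right x hyp)
          exact subsingleton_of_subsingleton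
        · obtain ⟨m, hm, hp'⟩ := coheight_lt_of_lt (lt_of_mem_support_cok hz hp) hq
          exact ih m hm p hyp hp' j (by omega)
    obtain ⟨δ, h1, h2⟩ := exists_connecting (c := c) (n := j)
      (IsLocalizedModule.map_injective _ (toLoc y _) (toLoc y _) _ (mul_injective hz))
      (IsLocalizedModule.map_exact (Submonoid.powers y) (toLoc y _) (toLoc y _) (toLoc y _) _ _ (mul_exact (q := q) (z := z)))
      (IsLocalizedModule.map_surjective (Submonoid.powers y) (toLoc y _) (toLoc y _) _ (Submodule.mkQ_surjective _))
    have hinj : ∀ x : TopLC A c (j + 1) (Loc y (A ⧸ q.asIdeal)), z • x = 0 → x = 0 := fun x hx ↦ by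
      rw [← lmap_lsmul, ← locMap_lsmul] at hx
      obtain ⟨y, rfl⟩ := (h2 x).1 hx
      rw [Subsingleton.elim y 0, map_zero]
    refine subsingleton_of_forall_eq 0 fun x ↦ ?_
    obtain ⟨k, hk⟩ := isTors_topLC c _ _ x
    have key : ∀ k, z ^ k • x = 0 → x = 0 := fun k ↦ by
      induction k with
      | zero => simp
      | succ k ihk => exact fun hk ↦ ihk (hinj _ (by rwa [smul_smul, ← pow_succ']))
    exact key k (hk _ (Ideal.pow_mem_pow hzc k))

lemma isTors_topLC_jacobson {J : Ideal A} (hJ : J ≤ Ideal.jacobson ⊥) {q : PrimeSpectrum A} {n : ℕ}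
    (hq : Order.coheight q ≤ n) {i : ℕ} (hi : n ≤ i) : IsTors J (TopLC A c i (A ⧸ q.asIdeal)) := by
  refine isTors_of_forall_span (IsNoetherian.noetherian J) fun y hy ↦ ?_
  by_cases hyq : y ∈ q.asIdeal
  · refine IsTors.topLC _ _ _ _ fun x ↦ ⟨1, (isTors_span_iff y).2 ?_⟩
    obtain ⟨x, rfl⟩ := Ideal.Quotient.mk_surjective x
    exact Ideal.Quotient.eq_zero_iff_mem.2 (q.asIdeal.mul_mem_right x (by simpa using hyq))
  have := topLC_loc c y (hJ hy) n q hyq hq i hi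
  have hinj : Function.Injective (toLoc y (A ⧸ q.asIdeal)) := by
    rw [injective_iff_map_eq_zero]
    intro x hx
    obtain ⟨k, hk⟩ := toLoc_eq_zero hx
    exact (injective_iff_map_eq_zero _).1 (mul_injective (z := y ^ k) fun h ↦ hyq (q.2.mem_of_pow_mem _ h)) x hk
  cases i with
  | zero =>
    have h := lmap_exact (c := c) (n := 0) hinj (LinearMap.exact_map_mkQ_range _) (Submodule.mkQ_surjective _)
    intro x
    have h0 : ((zeroth c _ (lmap c 0 (toLoc y (A ⧸ q.asIdeal)) x) : Gam c _) : Loc y (A ⧸ q.asIdeal)) = 0 := by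
      rw [Subsingleton.elim (lmap c 0 (toLoc y (A ⧸ q.asIdeal)) x) 0, map_zero]; rfl
    rw [zeroth_lmap] at h0
    have h1 : zeroth c _ x = 0 := Subtype.ext (hinj (by rw [h0]; simp))
    refine ⟨0, fun b _ ↦ ?_⟩
    rw [(zeroth c _).map_eq_zero_iff.1 h1, smul_zero]
  | succ j =>
    obtain ⟨δ, h1, h2⟩ := exists_connecting (c := c) (n := j) hinj (LinearMap.exact_map_mkQ_range _) (Submodule.mkQ_surjective _)
    exact ((isTors_loc_cokernel y).topLC _ _ _ _).of_surjective δ fun x ↦ (h2 x).1 (Subsingleton.elim _ _)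

end

section

variable {A : Type} [CommRing A]

/-- An `x`-torsion module is Artinian as soon as its submodule of elements killed by `x` is. -/
theorem isArtinian_of_ker (x : A) {M : Type} [AddCommGroup M] [Module A M]
    (hx : ∀ m : M, ∃ k, x ^ k • m = 0) [IsArtinian A (LinearMap.ker (LinearMap.lsmul A M x))] :
    IsArtinian A M := by
  rw [← monotone_stabilizes_iff_artinian]
  intro N'
  let N (n : ℕ) : Submodule A M := OrderDual.ofDual (N' n)
  have hN : ∀ {i j}, i ≤ j → N j ≤ N i := fun h ↦ N'.monotone h
  let S (k n : ℕ) : Submodule A (LinearMap.ker (LinearMap.lsmul A M x)) :=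
    ((N n).map (LinearMap.lsmul A M (x ^ k))).comap (Submodule.subtype _)
  have memS {k n v} : v ∈ S k n ↔ ∃ m ∈ N n, x ^ k • m = v := Iff.rfl
  have hS1 : ∀ k l m n, k ≤ l → m ≤ n → S l n ≤ S k m := by
    intro k l m n hkl hmn v hv
    obtain ⟨w, hw, h⟩ := memS.1 hv
    refine memS.2 ⟨x ^ (l - k) • w, hN hmn (Submodule.smul_mem (N n) _ hw), ?_⟩
    rw [smul_smul, ← pow_add, ← h, Nat.add_sub_cancel' hkl]
  obtain ⟨n₀, h₀⟩ := IsArtinian.monotone_stabilizes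
    (⟨fun n ↦ OrderDual.toDual (S n n), fun k l h ↦ hS1 k l k l h h⟩ :
      ℕ →o (Submodule A (LinearMap.ker (LinearMap.lsmul A M x)))ᵒᵈ)
  have h₀ : ∀ n ≥ n₀, S n₀ n₀ = S n n := h₀
  have h₁ : ∀ k, ∃ n, ∀ m ≥ n, S k n = S k m := fun k ↦ IsArtinian.monotone_stabilizes
    (⟨fun n ↦ OrderDual.toDual (S k n), fun m n h ↦ hS1 k k m n le_rfl h⟩ :
      ℕ →o (Submodule A (LinearMap.ker (LinearMap.lsmul A M x)))ᵒᵈ)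
  choose e he using h₁
  obtain ⟨n₁, hn₀, hn₁⟩ : ∃ n₁ ≥ n₀, ∀ k < n₀, e k ≤ n₁ :=
    ⟨n₀ + (Finset.range n₀).sup e, by omega,
      fun k hk ↦ (Finset.le_sup (f := e) (Finset.mem_range.2 hk)).trans (by omega)⟩
  have hS : ∀ n ≥ n₁, ∀ k, S k n₁ ≤ S k n := by
    intro n hn k
    rcases lt_or_ge k n₀ with hk | hk
    · rw [← he k n₁ (hn₁ k hk), ← he k n ((hn₁ k hk).trans hn)]
    · refine (hS1 n₀ k n₀ n₁ hk hn₀).trans ?_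
      rw [h₀ (max k n) (by omega)]
      exact hS1 _ _ _ _ (by omega) (by omega)
  refine ⟨n₁, fun n hn ↦ congrArg OrderDual.toDual (le_antisymm (a := N n₁) (b := N n) ?_ (hN hn))⟩
  have key : ∀ k, ∀ m ∈ N n₁, x ^ k • m = 0 → m ∈ N n := by
    intro k
    induction k with
    | zero =>
      intro m _ h
      rw [pow_zero, one_smul] at h
      rw [h]
      exact Submodule.zero_mem (N n)
    | succ k ih =>
      intro m hm h
      let v : LinearMap.ker (LinearMap.lsmul A M x) := ⟨x ^ k • m, by
        rw [LinearMap.mem_ker, LinearMap.lsmul_apply, smul_smul, ← pow_succ', h]⟩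
      have hv : v ∈ S k n₁ := memS.2 ⟨m, hm, rfl⟩
      obtain ⟨m', hm', h'⟩ := memS.1 (hS n hn k hv)
      have h'' := ih (m - m') (Submodule.sub_mem (N n₁) hm (hN hn hm')) (by rw [smul_sub, h', sub_self])
      simpa using Submodule.add_mem (N n) h'' hm'
  intro m hm
  obtain ⟨k, hk⟩ := hx m
  exact key k m hm hk

variable (c : Ideal A) [IsNoetherianRing A]

omit [IsNoetherianRing A] in
lemma isArtinian_of_exact {X Y Z : Type} [AddCommGroup X] [AddCommGroup Y] [AddCommGroup Z]
    [Module A X] [Module A Y] [Module A Z] {f : X →ₗ[A] Y} {g : Y →ₗ[A] Z} (h : Function.Exact f g)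
    [IsArtinian A X] [IsArtinian A Z] : IsArtinian A Y :=
  isArtinian_of_range_eq_ker f g (LinearMap.exact_iff.1 h).symm

theorem isArtinian_topLC {J : Ideal A} (hJ : J ≤ Ideal.jacobson ⊥)
    (hmax : ∀ p : PrimeSpectrum A, J ≤ p.asIdeal → p.asIdeal.IsMaximal) (n : ℕ) :
    ∀ q : PrimeSpectrum A, Order.coheight q ≤ n → ∀ i ≥ n, IsArtinian A (TopLC A c i (A ⧸ q.asIdeal)) := by
  induction n using Nat.strong_induction_on with
  | _ n ih =>
    intro q hq i hi
    by_cases hJq : J ≤ q.asIdeal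
    · have hm := hmax q hJq
      have h0 : Order.coheight q ≤ (0 : ℕ) := by
        rw [Nat.cast_zero, nonpos_iff_eq_zero, Order.coheight_eq_zero, PrimeSpectrum.isMax_iff]
        exact hm
      cases i with
      | zero =>
        have : IsSimpleModule A (A ⧸ q.asIdeal) := isSimpleModule_iff_quot_maximal.2 ⟨_, hm, ⟨LinearEquiv.refl _ _⟩⟩
        exact isArtinian_of_injective ((Gam c _).subtype ∘ₗ (zeroth c (A ⧸ q.asIdeal)).toLinearMap)
          ((Gam c _).subtype_injective.comp (zeroth c (A ⧸ q.asIdeal)).injective)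
      | succ i =>
        have := grothendieck c 0 q h0 (i + 1) (by omega)
        infer_instance
    · obtain ⟨x, hxJ, hx⟩ := SetLike.not_le_iff_exists.1 hJq
      have htors : ∀ m : TopLC A c i (A ⧸ q.asIdeal), ∃ k, x ^ k • m = 0 := fun m ↦ by
        obtain ⟨k, hk⟩ := isTors_topLC_jacobson c hJ hq hi m
        exact ⟨k, hk _ (Ideal.pow_mem_pow hxJ k)⟩
      have h : ∀ j, n ≤ j + 1 → IsArtinian A (TopLC A c j (Cok q x)) := fun j hj ↦
        prime_filtration (pr := fun N ↦ IsArtinian A (TopLC A c j N))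
          (fun N _ _ _ ↦ by have := subsingleton_of_subsingleton (A := A) (c := c) (n := j) (M := N); infer_instance)
          (fun _ _ _ _ _ _ _ _ _ _ _ hf h hg h1 h3 ↦ isArtinian_of_exact (lmap_exact hf h hg))
          _ fun p hp ↦ by
            obtain ⟨m, hm, hp'⟩ := coheight_lt_of_lt (lt_of_mem_support_cok hx hp) hq
            exact ih m hm p hp' j (by omega)
      have : IsArtinian A (LinearMap.ker (LinearMap.lsmul A (TopLC A c i (A ⧸ q.asIdeal)) x)) := by
        cases i with
        | zero =>
          have h1 := lmap_exact (c := c) (n := 0) (mul_injective hx) mul_exact (Submodule.mkQ_surjective _)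
          have : Subsingleton (LinearMap.ker (LinearMap.lsmul A (TopLC A c 0 (A ⧸ q.asIdeal)) x)) := by
            refine subsingleton_of_forall_eq 0 fun ⟨y, hy⟩ ↦ Subtype.ext ?_
            change x • y = 0 at hy
            have h2 : x • ((zeroth c _ y : Gam c _) : A ⧸ q.asIdeal) = 0 := by
              rw [← Submodule.coe_smul, ← map_smul, hy, map_zero]; rfl
            have h3 := (injective_iff_map_eq_zero _).1 (mul_injective hx) _ h2
            exact (zeroth c _).map_eq_zero_iff.1 (Subtype.ext h3)
          infer_instance
        | succ j =>
          have := h j hi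
          obtain ⟨δ, h1, h2⟩ := exists_connecting (c := c) (n := j) (mul_injective hx) mul_exact (Submodule.mkQ_surjective _)
          have h3 : ∀ y, x • δ y = 0 := fun y ↦ by rw [← lmap_lsmul]; exact (h2 _).2 ⟨y, rfl⟩
          refine isArtinian_of_surjective _ (δ.codRestrict (LinearMap.ker (LinearMap.lsmul A _ x)) h3) ?_
          rintro ⟨y, hy⟩
          obtain ⟨w, rfl⟩ := (h2 y).1 (by rw [lmap_lsmul]; exact hy)
          exact ⟨w, rfl⟩
      exact isArtinian_of_ker x htors

end

section

variable {A : Type} [CommRing A]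

section
variable {E : Type} [AddCommGroup E] [Module A E]

lemma exists_max_disjoint {S Y : Submodule A E} (h : Disjoint S Y) :
    ∃ X, S ≤ X ∧ Disjoint X Y ∧ ∀ Z, X ≤ Z → Disjoint Z Y → Z ≤ X := by
  obtain ⟨X, h1, h2⟩ := zorn_le_nonempty₀ {X : Submodule A E | Disjoint X Y}
    (fun c hc hch y hy ↦ ⟨sSup c, (DirectedOn.disjoint_sSup_left hch.directedOn).2 (fun Z hZ ↦ hc hZ),
      fun z hz ↦ le_sSup hz⟩) S h
  exact ⟨X, h1, h2.prop, fun Z h3 h4 ↦ h2.2 h4 h3⟩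

/-- A submodule of an injective module is injective if it is maximal among the submodules
disjoint from a given one. -/
theorem injective_of_max_disjoint [Module.Injective A E] {S X : Submodule A E} (hX : Disjoint X S)
    (hmax : ∀ Z, X ≤ Z → Disjoint Z S → Z ≤ X) : Module.Injective A X := by
  obtain ⟨Y, hSY, hY, hYmax⟩ := exists_max_disjoint hX.symm
  rw [Submodule.disjoint_def] at hX hY
  have hι : Function.Injective (Y.mkQ ∘ₗ X.subtype) := by
    rw [injective_iff_map_eq_zero]
    intro x hx
    have : (x : E) ∈ Y := (Submodule.Quotient.mk_eq_zero Y).1 hx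
    exact Subtype.ext (hY _ this x.2)
  obtain ⟨h, hh⟩ := Module.Injective.out _ hι X.subtype
  have hh : ∀ x ∈ X, h (Y.mkQ x) = x := fun x hx ↦ hh ⟨x, hx⟩
  have hr : LinearMap.range h ≤ X := by
    refine hmax _ (fun x hx ↦ ⟨_, hh x hx⟩) (Submodule.disjoint_def.2 ?_)
    rintro _ ⟨e, rfl⟩ hv
    obtain ⟨e, rfl⟩ := Submodule.mkQ_surjective _ e
    by_contra hne
    have he : e ∉ Y := fun he ↦ hne (by rw [Submodule.mkQ_apply, (Submodule.Quotient.mk_eq_zero Y).2 he, map_zero])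
    refine he (hYmax (Y ⊔ Submodule.span A {e}) le_sup_left (Submodule.disjoint_def.2 ?_)
      (Submodule.mem_sup_right (Submodule.mem_span_singleton_self e)))
    intro x hx hxX
    obtain ⟨y, hy, z, hz, rfl⟩ := Submodule.mem_sup.1 hx
    obtain ⟨a, rfl⟩ := Submodule.mem_span_singleton.1 hz
    refine hX _ hxX ?_
    rw [← hh _ hxX, map_add, Submodule.mkQ_apply, (Submodule.Quotient.mk_eq_zero Y).2 hy, zero_add,
      map_smul, map_smul]
    exact S.smul_mem _ hv
  refine ⟨fun P Q _ _ _ _ f hf g ↦ ?_⟩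
  obtain ⟨k, hk⟩ := Module.Injective.out f hf (X.subtype ∘ₗ g)
  refine ⟨(h.codRestrict X fun v ↦ hr ⟨v, rfl⟩) ∘ₗ Y.mkQ ∘ₗ k, fun x ↦ Subtype.ext ?_⟩
  change h (Y.mkQ (k (f x))) = g x
  rw [hk]
  exact hh _ (g x).2

end

variable {J : Ideal A}

lemma isSemisimpleModule_of_isTorsionBySet [IsSemisimpleRing (A ⧸ J)] {W : Type} [AddCommGroup W] [Module A W]
    (h : Module.IsTorsionBySet A W J) : IsSemisimpleModule A W :=
  h.isSemisimpleModule_iff.1 (letI := h.module; inferInstance)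

/-- The elements of `G` killed by `J`. -/
abbrev Tor (J : Ideal A) (G : Type) [AddCommGroup G] [Module A G] : Submodule A G :=
  Submodule.torsionBySet A G (J : Set A)

lemma mem_Tor {G : Type} [AddCommGroup G] [Module A G] {g : G} : g ∈ Tor J G ↔ ∀ a ∈ J, a • g = 0 :=
  (Submodule.mem_torsionBySet_iff _ _).trans ⟨fun h a ha ↦ h ⟨a, ha⟩, fun h a ↦ h a a.2⟩

lemma isSemisimple_Tor [IsSemisimpleRing (A ⧸ J)] (G : Type) [AddCommGroup G] [Module A G] :
    IsSemisimpleModule A (Tor J G) :=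
  isSemisimpleModule_of_isTorsionBySet (Submodule.torsionBySet_isTorsionBySet _)

lemma isSemisimple_quotient [IsSemisimpleRing (A ⧸ J)] : IsSemisimpleModule A (A ⧸ J) :=
  isSemisimpleModule_of_isTorsionBySet fun x a ↦ by
    obtain ⟨x, rfl⟩ := Ideal.Quotient.mk_surjective x
    exact Ideal.Quotient.eq_zero_iff_mem.2 (J.mul_mem_right x a.2)

lemma IsTors.exists_mem_Tor {G : Type} [AddCommGroup G] [Module A G] (h : IsTors J G) {g : G} (hg : g ≠ 0) :
    ∃ g' ∈ Tor J G, g' ≠ 0 := by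
  classical
  let k := Nat.find (h g)
  have hk : ∀ b ∈ J ^ k, b • g = 0 := Nat.find_spec (h g)
  have hk0 : k ≠ 0 := fun h0 ↦ hg (by simpa using hk 1 (by simp [h0]))
  obtain ⟨b, hb, hbg⟩ : ∃ b ∈ J ^ (k - 1), b • g ≠ 0 := by
    simpa using Nat.find_min (h g) (m := k - 1) (by omega)
  refine ⟨b • g, mem_Tor.2 fun a ha ↦ ?_, hbg⟩
  rw [smul_smul]
  refine hk _ ?_
  rw [← Nat.sub_one_add_one hk0, pow_succ']
  exact Ideal.mul_mem_mul ha hb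

/-- There is an injective module with Noetherian `J`-torsion detecting nonzero `J`-power-torsion modules. -/
theorem exists_cogenerator [IsNoetherianRing A] [IsSemisimpleRing (A ⧸ J)] :
    ∃ (E : Type) (_ : AddCommGroup E) (_ : Module A E), Module.Injective A E ∧
      IsNoetherian A (Tor J E) ∧
      ∀ (G : Type) [AddCommGroup G] [Module A G], IsTors J G → Nontrivial G → ∃ u : G →ₗ[A] E, u ≠ 0 := by
  obtain ⟨E', _, _, _, j, hj⟩ := exists_injective A (A ⧸ J)
  have hW : IsSemisimpleModule A (Tor J E') := isSemisimple_Tor E'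
  have hjW : LinearMap.range j ≤ Tor J E' := by
    rintro _ ⟨x, rfl⟩
    refine mem_Tor.2 fun a ha ↦ ?_
    obtain ⟨x, rfl⟩ := Ideal.Quotient.mk_surjective x
    rw [← map_smul]
    convert! map_zero j
    exact Ideal.Quotient.eq_zero_iff_mem.2 (J.mul_mem_right x ha)
  obtain ⟨C, hC⟩ := ComplementedLattice.exists_isCompl ((LinearMap.range j).comap (Tor J E').subtype)
  let C' := C.map (Tor J E').subtype
  have hd : Disjoint (LinearMap.range j) C' := by
    rw [Submodule.disjoint_def]
    rintro _ hx ⟨x, hxC, rfl⟩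
    have := Submodule.disjoint_def.1 hC.disjoint x hx hxC
    rw [this, map_zero]
  obtain ⟨X, hX1, hX2, hX3⟩ := exists_max_disjoint hd
  have hXi := injective_of_max_disjoint hX2 hX3
  have hXr : ∀ x ∈ Tor J X, (x : E') ∈ LinearMap.range j := by
    intro x hx
    have hxW : (x : E') ∈ Tor J E' := mem_Tor.2 fun a ha ↦ congrArg Subtype.val (mem_Tor.1 hx a ha)
    obtain ⟨s, hs, c, hc, h⟩ := Submodule.mem_sup.1
      (hC.codisjoint.eq_top ▸ Submodule.mem_top : (⟨x, hxW⟩ : Tor J E') ∈ _ ⊔ C)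
    have h : (s : E') + c = x := congrArg Subtype.val h
    have hc0 : (c : E') = 0 := Submodule.disjoint_def.1 hX2 c
      (by rw [← sub_eq_of_eq_add' h.symm]; exact X.sub_mem x.2 (hX1 hs)) ⟨c, hc, rfl⟩
    rw [← h, hc0, add_zero]
    exact hs
  refine ⟨X, inferInstance, inferInstance, hXi, ?_, ?_⟩
  · refine isNoetherian_of_injective ((X.subtype ∘ₗ (Tor J X).subtype).codRestrict (LinearMap.range j)
      fun x ↦ hXr x x.2) fun x y h ↦ ?_
    exact Subtype.ext (Subtype.ext (congrArg (LinearMap.range j).subtype h))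
  · intro G _ _ hG hne
    obtain ⟨g₀, hg₀⟩ := exists_ne (0 : G)
    obtain ⟨g, hgJ, hg⟩ := hG.exists_mem_Tor hg₀
    obtain ⟨m, hm, hgm⟩ := Ideal.exists_le_maximal (Ideal.torsionOf A G g) (by simpa using hg)
    have hJm : J ≤ m := fun a ha ↦ hgm (mem_Tor.1 hgJ a ha)
    have := isSemisimple_quotient (J := J)
    obtain ⟨σ, hσ⟩ := IsSemisimpleModule.lifting_property (Submodule.factor hJm)
      (Submodule.factor_surjective hJm) LinearMap.id
    have hι := Submodule.ker_liftQ_eq_bot' (Ideal.torsionOf A G g) (LinearMap.toSpanSingleton A G g) rfl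
    obtain ⟨u, hu⟩ := Module.Injective.out _ (LinearMap.ker_eq_bot.1 hι)
      ((j.codRestrict X fun v ↦ hX1 ⟨v, rfl⟩) ∘ₗ σ ∘ₗ Submodule.factor hgm)
    refine ⟨u, fun h0 ↦ ?_⟩
    have h1 := hu (Submodule.mkQ _ 1)
    have h2 : j (σ (Submodule.factor hgm (Submodule.mkQ _ 1))) = 0 := by
      rw [h0] at h1
      exact congrArg Subtype.val h1.symm
    have h3 : Submodule.factor hJm (σ (m.mkQ 1)) = m.mkQ 1 := LinearMap.congr_fun hσ _
    have h5 : σ (m.mkQ 1) = 0 := (map_eq_zero_iff j hj).1 h2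
    rw [h5, map_zero] at h3
    have h4 : (1 : A) ∈ m := (Submodule.Quotient.mk_eq_zero m).1 h3.symm
    exact hm.ne_top (m.eq_top_iff_one.2 h4)

end

section

variable {A : Type} [CommRing A] {J : Ideal A}

lemma pi_mem_smul_top {s : ℕ} {I : Ideal A} {x : Fin s → A} (hx : ∀ i, x i ∈ I) :
    x ∈ (I • ⊤ : Submodule A (Fin s → A)) := by
  rw [pi_eq_sum_univ x]
  exact Submodule.sum_mem _ fun i _ ↦ Submodule.smul_mem_smul (hx i) trivial

instance isPrecomplete_pi [IsPrecomplete J A] (s : ℕ) : IsPrecomplete J (Fin s → A) := by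
  refine ⟨fun f hf ↦ ?_⟩
  have h1 : ∀ i, ∃ L : A, ∀ n, f n i ≡ L [SMOD (J ^ n • ⊤ : Submodule A A)] := fun i ↦ by
    refine IsPrecomplete.prec' (fun n ↦ f n i) fun {m n} hmn ↦ ?_
    refine (SModEq.map (hf hmn) (LinearMap.proj i)).mono ?_
    rw [Submodule.map_smul'']
    exact Submodule.smul_mono le_rfl le_top
  choose L hL using h1
  refine ⟨L, fun n ↦ SModEq.sub_mem.2 (pi_mem_smul_top fun i ↦ ?_)⟩
  simpa using SModEq.sub_mem.1 (hL i n)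

section
variable {E : Type} [AddCommGroup E] [Module A E] {G : Type} [AddCommGroup G] [Module A G]

lemma isHausdorff_dual (hG : IsTors J G) : IsHausdorff J (G →ₗ[A] E) := by
  refine ⟨fun x hx ↦ LinearMap.ext fun g ↦ ?_⟩
  obtain ⟨k, hk⟩ := hG g
  have := SModEq.zero.1 (hx k)
  rw [LinearMap.zero_apply]
  refine Submodule.smul_induction_on (p := fun x ↦ x g = 0) this (fun a ha u _ ↦ ?_) fun x y h1 h2 ↦ ?_
  · rw [LinearMap.smul_apply, ← map_smul, hk a ha, map_zero]
  · rw [LinearMap.add_apply, h1, h2, add_zero]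

lemma mem_smul_top_dual [Module.Injective A E] (hJ : J.FG) (w : G →ₗ[A] E) (hw : ∀ g ∈ Tor J G, w g = 0) :
    w ∈ (J • ⊤ : Submodule A (G →ₗ[A] E)) := by
  obtain ⟨r, b, hb⟩ := Submodule.fg_iff_exists_fin_generating_family.1 hJ
  have hbJ : ∀ i, b i ∈ J := fun i ↦ hb ▸ Submodule.subset_span ⟨i, rfl⟩
  let μ : G →ₗ[A] Fin r → G := LinearMap.pi fun i ↦ LinearMap.lsmul A G (b i)
  have hμ : LinearMap.ker μ ≤ Tor J G := fun g hg ↦ mem_Tor.2 fun a ha ↦ by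
    rw [← hb] at ha
    refine Submodule.span_induction (p := fun a _ ↦ a • g = 0) ?_ (zero_smul _ _) ?_ ?_ ha
    · rintro _ ⟨i, rfl⟩
      exact congrFun (LinearMap.mem_ker.1 hg) i
    · intro x y _ _ hx hy
      rw [add_smul, hx, hy, add_zero]
    · intro a x _ hx
      rw [smul_assoc, hx, smul_zero]
  obtain ⟨v, hv⟩ := Module.Injective.out _ (LinearMap.ker_eq_bot.1 (Submodule.ker_liftQ_eq_bot' _ μ rfl))
    ((LinearMap.ker μ).liftQ w fun g hg ↦ hw g (hμ hg))
  have : w = ∑ i, b i • (v ∘ₗ LinearMap.single A (fun _ ↦ G) i) := by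
    ext g
    have h1 : v (μ g) = w g := hv (Submodule.mkQ _ g)
    rw [← h1, LinearMap.sum_apply]
    simp only [LinearMap.smul_apply, LinearMap.comp_apply, ← map_smul, ← map_sum]
    congr 1
    exact (LinearMap.sum_single_apply _ (μ g)).symm
  rw [this]
  exact Submodule.sum_mem _ fun i _ ↦ Submodule.smul_mem_smul (hbJ i) trivial

/-- The dual of an Artinian module over a complete ring is finitely generated. -/
theorem finite_dual [IsNoetherianRing A] [IsSemisimpleRing (A ⧸ J)] [IsPrecomplete J A]
    [Module.Injective A E] [IsNoetherian A (Tor J E)] [IsArtinian A G] (hG : IsTors J G) :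
    Module.Finite A (G →ₗ[A] E) := by
  have := isHausdorff_dual (E := E) hG
  have := isSemisimple_Tor (J := J) G
  have h : IsArtinian A (Tor J G) ↔ Module.Finite A (Tor J G) := IsSemisimpleModule.finite_tfae.out 2 0
  have : Module.Finite A (Tor J G) := h.1 inferInstance
  let ρ : (G →ₗ[A] E) →ₗ[A] Tor J G →ₗ[A] E := LinearMap.lcomp A E (Tor J G).subtype
  let τ : (Tor J G →ₗ[A] Tor J E) →ₗ[A] Tor J G →ₗ[A] E :=
    LinearMap.compRight A (Tor J E).subtype
  have hρτ : LinearMap.range ρ ≤ LinearMap.range τ := by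
    rintro _ ⟨u, rfl⟩
    refine ⟨(u ∘ₗ (Tor J G).subtype).codRestrict (Tor J E) fun g ↦ mem_Tor.2 fun a ha ↦ ?_, rfl⟩
    rw [← map_smul, show a • g = 0 from Subtype.ext (mem_Tor.1 g.2 a ha), map_zero]
  have : IsNoetherian A (LinearMap.range ρ) := isNoetherian_of_le hρτ
  have : IsNoetherian A ((G →ₗ[A] E) ⧸ LinearMap.ker ρ) :=
    isNoetherian_of_linearEquiv ρ.quotKerEquivRange.symm
  have hker : LinearMap.ker ρ ≤ J • ⊤ := fun w hw ↦ mem_smul_top_dual (IsNoetherian.noetherian J) w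
    fun g hg ↦ LinearMap.congr_fun (LinearMap.mem_ker.1 hw) ⟨g, hg⟩
  have : Module.Finite A ((G →ₗ[A] E) ⧸ (J • ⊤ : Submodule A (G →ₗ[A] E))) :=
    Module.Finite.of_surjective _ (Submodule.factor_surjective hker)
  obtain ⟨s, f, hf⟩ := Module.Finite.exists_fin' A ((G →ₗ[A] E) ⧸ (J • ⊤ : Submodule A (G →ₗ[A] E)))
  obtain ⟨F, hF⟩ := Module.projective_lifting_property _ f (Submodule.mkQ_surjective _)
  exact Module.Finite.of_surjective F (surjective_of_mkQ_comp_surjective (I := J) (hF ▸ hf))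

end

end

section

variable {A : Type} [CommRing A] {J : Ideal A}

lemma isMaximal_of_le_of_isSemisimpleRing [IsSemisimpleRing (A ⧸ J)] (p : PrimeSpectrum A) (hp : J ≤ p.asIdeal) :
    p.asIdeal.IsMaximal := by
  have hs : Function.Surjective (Ideal.Quotient.factor hp) := Ideal.Quotient.factor_surjective hp
  have : IsArtinianRing (A ⧸ J) := inferInstance
  have : IsArtinianRing (A ⧸ p.asIdeal) := hs.isArtinianRing
  exact Ideal.Quotient.maximal_of_isField _ (IsArtinianRing.isField_of_isDomain _)

variable (c : Ideal A) [IsNoetherianRing A]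

lemma exists_smul_eq_zero (i : ℕ) (Q : PrimeSpectrum A) (hQ : Subsingleton (TopLC A c i (A ⧸ Q.asIdeal)))
    (N : Type) [AddCommGroup N] [Module A N] [Module.Finite A N]
    (hN : ∀ p ∈ Module.support A N, p ≤ Q → p = Q) :
    ∃ t ∉ Q.asIdeal, ∀ z : TopLC A c i N, t • z = 0 := by
  refine prime_filtration (A := A) (pr := fun N ↦ ∃ t ∉ Q.asIdeal, ∀ z : TopLC A c i N, t • z = 0)
    ?_ ?_ N ?_
  · intro N _ _ hN
    have := subsingleton_of_subsingleton (c := c) (n := i) (M := N)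
    exact ⟨1, Q.asIdeal.ne_top_iff_one.1 Q.isPrime.ne_top, fun z ↦ Subsingleton.elim _ _⟩
  · rintro N₁ N₂ N₃ _ _ _ _ _ _ f g hf h hg ⟨t, ht, h1⟩ ⟨s, hs, h3⟩
    refine ⟨t * s, fun hts ↦ (Q.isPrime.mem_or_mem hts).elim ht hs, fun z ↦ ?_⟩
    obtain ⟨y, hy⟩ := (lmap_exact (c := c) (n := i) hf h hg (s • z)).1 (by rw [map_smul, h3])
    rw [mul_smul, ← hy, ← map_smul, h1, map_zero]
  · intro p hp
    by_cases hpQ : p ≤ Q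
    · rw [hN p hp hpQ]
      exact ⟨1, Q.asIdeal.ne_top_iff_one.1 Q.isPrime.ne_top, fun z ↦ Subsingleton.elim _ _⟩
    · obtain ⟨t, htp, htQ⟩ := Set.not_subset.1 (show ¬ (p.asIdeal : Set A) ⊆ Q.asIdeal from hpQ)
      refine ⟨t, htQ, fun z ↦ ?_⟩
      have : LinearMap.lsmul A (A ⧸ p.asIdeal) t = 0 := by
        refine LinearMap.ext fun x ↦ ?_
        obtain ⟨x, rfl⟩ := Ideal.Quotient.mk_surjective x
        exact Ideal.Quotient.eq_zero_iff_mem.2 (p.asIdeal.mul_mem_right x htp)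
      rw [← lmap_lsmul, this, lmap_zero, LinearMap.zero_apply]

/-- If `G` is a divisible Artinian module over the domain `A / q` and `t` kills the kernel of multiplication by
`x` on `G`, then `t` lies in the radical of `q + (x)`. -/
lemma subsingleton_of_dual [IsSemisimpleRing (A ⧸ J)] [IsPrecomplete J A] {G : Type} [AddCommGroup G] [Module A G]
    [IsArtinian A G] (hG : IsTors J G) {q Q : Ideal A} [Q.IsPrime] (hqQ : q ≤ Q)
    (hdiv : ∀ z ∉ q, ∀ g : G, ∃ g', z • g' = g)
    {x t : A} (hxQ : x ∈ Q) (htQ : t ∉ Q) (hx : ∀ g : G, ∃ g', x • g' = g)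
    (ht : ∀ g : G, x • g = 0 → t • g = 0) : Subsingleton G := by
  by_contra hne
  rw [not_subsingleton_iff_nontrivial] at hne
  obtain ⟨E, _, _, _, _, hE⟩ := exists_cogenerator (J := J)
  obtain ⟨u₀, hu₀⟩ := hE G hG hne
  have := finite_dual (E := E) hG
  have hx' : Function.Surjective (LinearMap.lsmul A G x) := hx
  let φ : G →ₗ[A] G := (Submodule.liftQ _ (LinearMap.lsmul A G t) ht) ∘ₗ
    ((LinearMap.lsmul A G x).quotKerEquivOfSurjective hx').symm.toLinearMap
  have hφ : ∀ g, φ (x • g) = t • g := fun g ↦ by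
    have : ((LinearMap.lsmul A G x).quotKerEquivOfSurjective hx').symm (x • g) = Submodule.mkQ _ g := by
      rw [LinearEquiv.symm_apply_eq]
      rfl
    change Submodule.liftQ _ (LinearMap.lsmul A G t) ht
      (((LinearMap.lsmul A G x).quotKerEquivOfSurjective hx').symm (x • g)) = _
    rw [this]
    rfl
  have hrange : LinearMap.range (LinearMap.lsmul A (G →ₗ[A] E) t) ≤ Ideal.span {x} • ⊤ := by
    rintro _ ⟨u, rfl⟩
    have : t • u = x • (u ∘ₗ φ) := LinearMap.ext fun g ↦ by
      rw [LinearMap.smul_apply, LinearMap.smul_apply, LinearMap.comp_apply, ← map_smul, ← map_smul, ← map_smul, hφ]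
    rw [LinearMap.lsmul_apply, this]
    exact Submodule.smul_mem_smul (Ideal.mem_span_singleton_self x) trivial
  obtain ⟨p, hp, -, hpc, hp0⟩ :=
    LinearMap.exists_monic_and_natDegree_eq_and_coeff_mem_pow_and_aeval_eq_zero A _ _ hrange
  have hev : p.eval t • u₀ = 0 := by
    have h1 : (LinearMap.lsmul A (G →ₗ[A] E)) t = algebraMap A (Module.End A (G →ₗ[A] E)) t := rfl
    rw [h1, Polynomial.aeval_algebraMap_apply] at hp0
    simpa using LinearMap.congr_fun hp0 u₀
  have hmem : p.eval t ∈ q := by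
    by_contra hn
    refine hu₀ (LinearMap.ext fun g ↦ ?_)
    obtain ⟨g, rfl⟩ := hdiv _ hn g
    rw [map_smul]
    exact LinearMap.congr_fun hev g
  have hxQ' : Ideal.span {x} ≤ Q := (Ideal.span_singleton_le_iff_mem _).2 hxQ
  have h2 : p.eval t = t ^ p.natDegree + ∑ i ∈ Finset.range p.natDegree, p.coeff i * t ^ i := by
    conv_lhs => rw [hp.as_sum]
    simp [Polynomial.eval_finsetSum]
  have h3 : t ^ p.natDegree ∈ Q := by
    rw [← sub_eq_of_eq_add h2]
    refine Q.sub_mem (hqQ hmem) (Q.sum_mem fun i hi ↦ Q.mul_mem_right _ (hxQ' ?_))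
    have := Finset.mem_range.1 hi
    exact Ideal.pow_le_self (by omega) (hpc i)
  exact htQ (Ideal.IsPrime.mem_of_pow_mem ‹_› _ h3)

/-- The Hartshorne–Lichtenbaum vanishing theorem. -/
theorem hartshorne_lichtenbaum [IsSemisimpleRing (A ⧸ J)] [IsAdicComplete J A] (n : ℕ) :
    ∀ q : PrimeSpectrum A, Order.coheight q ≤ n → ∀ P : PrimeSpectrum A, c ≤ P.asIdeal → q ≤ P → ¬ J ≤ P.asIdeal →
      ∀ i ≥ n, Subsingleton (TopLC A c i (A ⧸ q.asIdeal)) := by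
  have hJ : J ≤ Ideal.jacobson ⊥ := IsAdicComplete.le_jacobson_bot J
  induction n using Nat.strong_induction_on with
  | _ n ih =>
    intro q hq P hcP hqP hJP i hi
    obtain ⟨m, hm, hPm⟩ := Ideal.exists_le_maximal P.asIdeal P.isPrime.ne_top
    let m' : PrimeSpectrum A := ⟨m, hm.isPrime⟩
    have hJm : J ≤ m := hJ.trans (sInf_le ⟨bot_le, hm⟩)
    have hPm' : P < m' := lt_of_le_of_ne hPm fun h ↦ hJP (h ▸ hJm)
    obtain ⟨_, h0, -⟩ := coheight_lt_of_lt (hqP.trans_lt hPm') hq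
    obtain ⟨i, rfl⟩ := Nat.exists_eq_succ_of_ne_zero (show i ≠ 0 by omega)
    by_cases hcq : c ≤ q.asIdeal
    · exact topLC_quotient_of_le c hcq
    obtain ⟨x, hxc, hxq⟩ := Set.not_subset.1 hcq
    obtain ⟨Q, hQ, hQP⟩ := Ideal.exists_minimalPrimes_le (I := q.asIdeal ⊔ Ideal.span {x}) (J := P.asIdeal)
      (sup_le hqP ((Ideal.span_singleton_le_iff_mem _).2 (hcP hxc)))
    let Q' : PrimeSpectrum A := ⟨Q, hQ.1.1⟩
    have hqQ : q ≤ Q' := le_sup_left.trans hQ.1.2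
    have hxQ : x ∈ Q := hQ.1.2 (Ideal.mem_sup_right (Ideal.mem_span_singleton_self x))
    obtain ⟨k, hk, hQk⟩ := coheight_lt_of_lt (lt_of_le_of_ne hqQ fun h ↦ hxq (h ▸ hxQ)) hq
    obtain ⟨t, htQ, ht⟩ := exists_smul_eq_zero c i Q'
      (ih k hk Q' hQk P hcP hQP hJP i (by omega)) (Cok q x) fun p hp hpQ ↦ le_antisymm hpQ
        (hQ.2 ⟨p.isPrime, le_of_mem_support_cok hp⟩ hpQ)
    have hdiv : ∀ z ∉ q.asIdeal, ∀ g : TopLC A c (i + 1) (A ⧸ q.asIdeal), ∃ g', z • g' = g := fun z hz ↦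
      smul_surjective_of_cok c hz (grothendieck_cok c hz hq hi)
    have := isArtinian_topLC c hJ isMaximal_of_le_of_isSemisimpleRing n q hq (i + 1) hi
    have := hQ.1.1
    refine subsingleton_of_dual (J := J) (isTors_topLC_jacobson c hJ hq hi) hqQ hdiv hxQ htQ (hdiv x hxq) fun g hg ↦ ?_
    obtain ⟨δ, h1, h2⟩ := exists_connecting (c := c) (n := i) (mul_injective hxq) mul_exact (Submodule.mkQ_surjective _)
    rw [← lmap_lsmul] at hg
    obtain ⟨y, rfl⟩ := (h2 g).1 hg
    rw [← map_smul, ht, map_zero]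

end

section

variable {A : Type} [CommRing A] {J : Ideal A}

section
variable (S : Set (PrimeSpectrum A)) (N : Type) [AddCommGroup N] [Module A N]

/-- The elements of `N` vanishing in the localizations at the primes in `S`. -/
def locKer : Submodule A N where
  carrier := {n | ∀ q ∈ S, ∃ s ∉ q.asIdeal, s • n = 0}
  add_mem' := by
    intro x y hx hy q hq
    obtain ⟨s, hs, h1⟩ := hx q hq
    obtain ⟨t, ht, h2⟩ := hy q hq
    refine ⟨s * t, fun hst ↦ (q.isPrime.mem_or_mem hst).elim hs ht, ?_⟩
    rw [smul_add, mul_smul, mul_smul, h2, smul_comm, h1, smul_zero, smul_zero, add_zero]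
  zero_mem' := fun q _ ↦ ⟨1, q.asIdeal.ne_top_iff_one.1 q.isPrime.ne_top, smul_zero _⟩
  smul_mem' := by
    intro a x hx q hq
    obtain ⟨s, hs, h⟩ := hx q hq
    exact ⟨s, hs, by rw [smul_comm, h, smul_zero]⟩

variable {S N}

lemma mem_locKer {n : N} : n ∈ locKer S N ↔ ∀ q ∈ S, ∃ s ∉ q.asIdeal, s • n = 0 := Iff.rfl

lemma notMem_of_mem_support_locKer {p : PrimeSpectrum A} (hp : p ∈ Module.support A (locKer S N)) : p ∉ S := by
  intro h
  obtain ⟨m, hm⟩ := Module.mem_support_iff'.1 hp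
  obtain ⟨s, hs, h⟩ := mem_locKer.1 m.2 p h
  exact hm s hs (Subtype.ext h)

lemma exists_le_of_mem_support_quotient_locKer [IsNoetherianRing A] [Module.Finite A N] {P : PrimeSpectrum A}
    (hP : P ∈ Module.support A (N ⧸ locKer S N)) :
    ∃ p ∈ Module.support A N, p ≤ P ∧ ∃ q ∈ S, p ≤ q := by
  obtain ⟨p, hp, hpP⟩ := Ideal.exists_minimalPrimes_le (Module.mem_support_iff_of_finite.1 hP)
  have hpa := Module.associatedPrimes.minimalPrimes_annihilator_subset_associatedPrimes _ _ hp
  obtain ⟨_, f, hf⟩ := (isAssociatedPrime_iff_exists_injective_linearMap _ _).1 hpa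
  refine ⟨⟨p, hp.1.1⟩, ?_, hpP, ?_⟩
  · have : (⟨p, hp.1.1⟩ : PrimeSpectrum A) ∈ Module.support A (N ⧸ locKer S N) :=
      Module.mem_support_iff_of_finite.2 hp.1.2
    exact Module.support_subset_of_surjective _ (Submodule.mkQ_surjective _) this
  obtain ⟨n, hn⟩ := Submodule.mkQ_surjective _ (f (Submodule.mkQ p 1))
  have hnK : n ∉ locKer S N := fun h ↦ by
    rw [Submodule.mkQ_apply, (Submodule.Quotient.mk_eq_zero _).2 h, eq_comm, map_eq_zero_iff f hf,
      Submodule.mkQ_apply, Submodule.Quotient.mk_eq_zero] at hn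
    exact hp.1.1.ne_top (p.eq_top_iff_one.2 hn)
  rw [mem_locKer] at hnK
  push Not at hnK
  obtain ⟨q, hq, hqn⟩ := hnK
  refine ⟨q, hq, fun s hs ↦ ?_⟩
  by_contra hsq
  have hsn : s • n ∈ locKer S N := by
    rw [← Submodule.Quotient.mk_eq_zero, Submodule.Quotient.mk_smul, ← Submodule.mkQ_apply, hn, ← map_smul, ← map_smul,
      Submodule.mkQ_apply, (Submodule.Quotient.mk_eq_zero p).2 (by simpa using hs), map_zero]
  obtain ⟨t, ht, h⟩ := mem_locKer.1 hsn q hq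
  exact hqn (t * s) (fun hts ↦ (q.isPrime.mem_or_mem hts).elim ht hsq) (by rw [mul_smul, h])

end

variable [IsNoetherianRing A]

lemma Gam_eq_of_le_radical {a c : Ideal A} (hcJ : c ≤ J) (h : J ≤ (c ⊔ a).radical) {W : Type} [AddCommGroup W]
    [Module A W] (hW : IsTors a W) : Gam c W = Gam J W := by
  ext x
  rw [mem_Gam, mem_Gam]
  constructor
  · rintro ⟨k, hk⟩
    obtain ⟨l, hl⟩ := hW x
    obtain ⟨m, hm⟩ := Ideal.exists_pow_le_of_le_radical_of_fg (I := J) (J := Ideal.torsionOf A W x)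
      (h.trans (Ideal.radical_le_radical_iff.2 (sup_le
        (fun b hb ↦ ⟨k, hk _ (Ideal.pow_mem_pow hb k)⟩) (fun b hb ↦ ⟨l, hl _ (Ideal.pow_mem_pow hb l)⟩))))
        (IsNoetherian.noetherian J)
    exact ⟨m, fun b hb ↦ hm hb⟩
  · rintro ⟨k, hk⟩
    exact ⟨k, fun b hb ↦ hk b (Ideal.pow_right_mono hcJ k hb)⟩

omit [IsNoetherianRing A] in
lemma topLC_equiv_of_subsingleton {c : Ideal A} {n : ℕ} {N : Type} [AddCommGroup N] [Module A N] (K : Submodule A N)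
    (h1 : Subsingleton (TopLC A c n K)) (h2 : Subsingleton (TopLC A c (n + 1) K)) :
    Nonempty (TopLC A c n N ≃ₗ[A] TopLC A c n (N ⧸ K)) := by
  have he : Function.Exact K.subtype K.mkQ := LinearMap.exact_subtype_mkQ K
  obtain ⟨δ, hδ, -⟩ := exists_connecting (c := c) (n := n) K.injective_subtype he K.mkQ_surjective
  refine ⟨LinearEquiv.ofBijective (lmap c n K.mkQ) ⟨?_, fun y ↦ (hδ y).1 (Subsingleton.elim _ _)⟩⟩
  rw [injective_iff_map_eq_zero]
  intro x hx
  obtain ⟨y, rfl⟩ := (lmap_exact (c := c) (n := n) K.injective_subtype he K.mkQ_surjective x).1 hx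
  rw [Subsingleton.elim y 0, map_zero]

/-- Over a complete ring, the top local cohomology module of `N` with respect to `c ≤ J` only depends on the set of
primes `q` of maximal dimension in the support of `N` with `J ≤ √(c + q)`. -/
theorem topLC_equiv_of_radical [IsSemisimpleRing (A ⧸ J)] [IsAdicComplete J A] {N : Type} [AddCommGroup N] [Module A N]
    [Module.Finite A N] {d : ℕ} (hd : ∀ q ∈ Module.support A N, Order.coheight q ≤ d) {c₁ c₂ : Ideal A}
    (h₁ : c₁ ≤ J) (h₂ : c₂ ≤ J) (H : ∀ q ∈ Module.support A N, Order.coheight q = d →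
      (J ≤ (c₁ ⊔ q.asIdeal).radical ↔ J ≤ (c₂ ⊔ q.asIdeal).radical)) :
    Nonempty (TopLC A c₁ d N ≃ₗ[A] TopLC A c₂ d N) := by
  let S : Set (PrimeSpectrum A) := {q | q ∈ Module.support A N ∧ Order.coheight q = d ∧ J ≤ (c₁ ⊔ q.asIdeal).radical}
  let K := locKer S N
  have hK : ∀ c : Ideal A, (∀ q ∈ Module.support A N, Order.coheight q = d →
      (J ≤ (c₁ ⊔ q.asIdeal).radical ↔ J ≤ (c ⊔ q.asIdeal).radical)) → ∀ i ≥ d, Subsingleton (TopLC A c i K) := by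
    intro c hc i hi
    refine vanish_of_primes c i K fun p hp ↦ ?_
    have hpN : p ∈ Module.support A N := Module.support_subset_of_injective _ K.injective_subtype hp
    have hpS : p ∉ S := notMem_of_mem_support_locKer hp
    by_cases hpd : Order.coheight p = d
    · have hJ : ¬ J ≤ (c ⊔ p.asIdeal).radical := fun h ↦ hpS ⟨hpN, hpd, (hc p hpN hpd).2 h⟩
      rw [Ideal.radical_eq_sInf, le_sInf_iff] at hJ
      push Not at hJ
      obtain ⟨P, ⟨hP, hPp⟩, hJP⟩ := hJ
      exact hartshorne_lichtenbaum c d p hpd.le ⟨P, hPp⟩ (le_sup_left.trans hP) (le_sup_right.trans hP) hJP i hi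
    · have hlt : Order.coheight p < d := lt_of_le_of_ne (hd p hpN) hpd
      lift Order.coheight p to ℕ using (hlt.trans_le le_top).ne with m hm
      have hmd : m < d := by exact_mod_cast hlt
      exact grothendieck c m p hm.ge i (by omega)
  obtain ⟨e₁⟩ := topLC_equiv_of_subsingleton K (hK c₁ (fun _ _ _ ↦ Iff.rfl) d le_rfl)
    (hK c₁ (fun _ _ _ ↦ Iff.rfl) (d + 1) (by omega))
  obtain ⟨e₂⟩ := topLC_equiv_of_subsingleton K (hK c₂ H d le_rfl) (hK c₂ H (d + 1) (by omega))
  have hrad : ∀ c : Ideal A, (∀ q ∈ S, J ≤ (c ⊔ q.asIdeal).radical) →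
      J ≤ (c ⊔ Module.annihilator A (N ⧸ K)).radical := by
    intro c hc
    rw [Ideal.radical_eq_sInf, le_sInf_iff]
    rintro P ⟨hP, hPp⟩
    obtain ⟨p, hpN, hpP, q, hq, hpq⟩ := exists_le_of_mem_support_quotient_locKer (S := S) (P := ⟨P, hPp⟩)
      (Module.mem_support_iff_of_finite.2 (le_sup_right.trans hP) : _ ∈ Module.support A (N ⧸ K))
    obtain rfl : p = q := by
      by_contra hne
      have := Order.coheight_le_coe_iff.1 (hd p hpN) q (lt_of_le_of_ne hpq hne)
      exact this.ne hq.2.1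
    exact (hc p hq).trans (hPp.radical_le_iff.2 (sup_le (le_sup_left.trans hP) hpP))
  have hG₁ := hrad c₁ fun q hq ↦ hq.2.2
  have hG₂ := hrad c₂ fun q hq ↦ (H q hq.1 hq.2.1).1 hq.2.2
  obtain ⟨e⟩ := IsTors.topLC_equiv (Module.annihilator A (N ⧸ K)) (c₁ := c₁) (c₂ := c₂)
    (fun W _ _ hW ↦ (Gam_eq_of_le_radical h₁ hG₁ hW).trans (Gam_eq_of_le_radical h₂ hG₂ hW).symm) d (N ⧸ K)
    fun x ↦ ⟨1, fun b hb ↦ Module.mem_annihilator.1 (by simpa using hb) x⟩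
  exact ⟨(e₁.trans e).trans e₂.symm⟩

end

section

section Completion

variable {R : Type} [CommRing R]

/-- A homomorphism into a complete ring carrying `𝔛` into the ideal of definition extends to the `𝔛`-adic
completion. -/
lemma exists_completion_lift {B S : Type} [CommRing B] [CommRing S] (𝔛 : Ideal B) (J : Ideal S) [IsAdicComplete J S]
    (g : B →+* S) (hg : 𝔛.map g ≤ J) :
    ∃ f : AdicCompletion 𝔛 B →+* S, f.comp (algebraMap B (AdicCompletion 𝔛 B)) = g := by
  have hle : ∀ n, 𝔛 ^ n ≤ (J ^ n).comap g := fun n ↦ by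
    rw [← Ideal.map_le_iff_le_comap, Ideal.map_pow]
    exact Ideal.pow_right_mono hg n
  let F : (n : ℕ) → AdicCompletion 𝔛 B →+* S ⧸ J ^ n := fun n ↦
    (Ideal.quotientMap (J ^ n) g (hle n)).comp (AdicCompletion.evalₐ 𝔛 n).toRingHom
  have hF : ∀ {m n : ℕ} (h : m ≤ n), (Ideal.Quotient.factorPow J h).comp (F n) = F m := by
    intro m n h
    ext x
    obtain ⟨x, rfl⟩ := AdicCompletion.mk_surjective 𝔛 B x
    have h1 : ∀ k, F k (AdicCompletion.mk 𝔛 B x) = Ideal.Quotient.mk _ (g (x k)) := fun k ↦ by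
      simp [F]
    simp only [RingHom.comp_apply, h1]
    change Ideal.Quotient.mk _ (g (x n)) = _
    rw [Ideal.Quotient.eq, ← map_sub]
    have h2 := AdicCompletion.Ideal.mk_eq_mk 𝔛 h x
    rw [Ideal.Quotient.eq] at h2
    exact hle m (by simpa using h2)
  refine ⟨IsAdicComplete.liftRingHom J F hF, ?_⟩
  ext b
  rw [← sub_eq_zero]
  refine IsHausdorff.haus (I := J) inferInstance _ fun n ↦ ?_
  rw [SModEq.zero]
  simp only [smul_eq_mul, Ideal.mul_top]
  rw [← Ideal.Quotient.eq_zero_iff_mem, map_sub, sub_eq_zero]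
  rw [RingHom.comp_apply, IsAdicComplete.mk_liftRingHom]
  simp [F, AdicCompletion.algebraMap_apply]

lemma completion_surjective {𝔐 : Ideal R} (fg : 𝔐.FG) (t : AdicCompletion 𝔐 R) :
    ∃ r : R, t - algebraMap R _ r ∈ 𝔐.map (algebraMap R (AdicCompletion 𝔐 R)) := by
  obtain ⟨r, hr⟩ := Ideal.Quotient.mk_surjective (AdicCompletion.evalOneₐ 𝔐 t)
  refine ⟨r, ?_⟩
  rw [← AdicCompletion.ker_evalOneₐ_eq_map 𝔐 fg, RingHom.mem_ker, map_sub, sub_eq_zero]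
  exact hr.symm

theorem isNoetherianRing_adicCompletion [IsNoetherianRing R] (𝔐 : Ideal R) :
    IsNoetherianRing (AdicCompletion 𝔐 R) := by
  have fg : 𝔐.FG := IsNoetherian.noetherian 𝔐
  obtain ⟨s, hs⟩ := fg
  let T := AdicCompletion 𝔐 R
  let B := MvPolynomial s R
  let 𝔛 : Ideal B := MvPolynomial.idealOfVars s R
  let J : Ideal T := 𝔐.map (algebraMap R T)
  have hfg : 𝔐.FG := ⟨s, hs⟩
  have : IsAdicComplete J T := AdicCompletion.isAdicComplete_self 𝔐 hfg
  let g : B →+* T := MvPolynomial.eval₂Hom (algebraMap R T) fun i ↦ algebraMap R T i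
  have hg : 𝔛.map g = J := by
    rw [Ideal.map_span, ← Set.range_comp]
    have h1 : J = Ideal.map (algebraMap R T) (Ideal.span s) :=
      congrArg (Ideal.map (algebraMap R T)) hs.symm
    rw [h1, Ideal.map_span]
    congr 1
    have h2 : ∀ i, g (MvPolynomial.X i) = algebraMap R T i := MvPolynomial.eval₂Hom_X' _ _
    ext x
    simp [h2]
  obtain ⟨f, hf⟩ := exists_completion_lift 𝔛 J g hg.le
  let I := 𝔛.map (algebraMap B (AdicCompletion 𝔛 B))
  have hfI : I.map f = J := by rw [Ideal.map_map, hf, hg]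
  have hc : IsAdicComplete I (AdicCompletion 𝔛 B) :=
    AdicCompletion.isAdicComplete_self 𝔛 (MvPolynomial.idealOfVars_fg s R)
  have : IsHausdorff (I.map f) T := by rw [hfI]; infer_instance
  have : IsNoetherianRing (AdicCompletion 𝔛 B) :=
    isNoetherianRing_of_ringEquiv _ (MvPowerSeries.toAdicCompletionAlgEquiv s R).toRingEquiv
  refine isNoetherianRing_of_surjective _ _ f (surjective_of_mk_map_comp_surjective (I := I) f ?_)
  intro t
  obtain ⟨t, rfl⟩ := Ideal.Quotient.mk_surjective t
  obtain ⟨r, hr⟩ := completion_surjective hfg t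
  refine ⟨algebraMap B _ (MvPolynomial.C r), ?_⟩
  rw [RingHom.comp_apply, ← RingHom.comp_apply f, hf, eq_comm, Ideal.Quotient.eq, hfI]
  have h2 : g (MvPolynomial.C r) = algebraMap R T r := MvPolynomial.eval₂Hom_C _ _ _
  rwa [h2]

lemma isSemisimpleRing_quotient {P : Set (PrimeSpectrum R)} (hPfin : P.Finite)
    (hPmax : ∀ p ∈ P, p.asIdeal.IsMaximal) {𝔐 : Ideal R} (h𝔐 : 𝔐 = ⨅ p ∈ P, p.asIdeal) :
    IsSemisimpleRing (R ⧸ 𝔐) := by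
  have := hPfin.to_subtype
  have h1 : 𝔐 = ⨅ p : P, p.1.asIdeal := by rw [h𝔐, iInf_subtype]
  have hm : ∀ p : P, p.1.asIdeal.IsMaximal := fun p ↦ hPmax p.1 p.2
  have hcop : Pairwise (Function.onFun IsCoprime fun p : P ↦ p.1.asIdeal) := by
    intro p q hpq
    refine Ideal.isCoprime_of_isMaximal fun h ↦ hpq (Subtype.ext (PrimeSpectrum.ext h))
  have e := (Ideal.quotEquivOfEq h1).trans (Ideal.quotientInfRingEquivPiQuotient _ hcop)
  have : ∀ p : P, IsSemisimpleRing (R ⧸ p.1.asIdeal) := fun p ↦ by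
    let _ := Ideal.Quotient.field p.1.asIdeal
    infer_instance
  exact e.symm.isSemisimpleRing

lemma isSemisimpleRing_completion_quotient {𝔐 : Ideal R} (fg : 𝔐.FG) [IsSemisimpleRing (R ⧸ 𝔐)] :
    IsSemisimpleRing (AdicCompletion 𝔐 R ⧸ 𝔐.map (algebraMap R (AdicCompletion 𝔐 R))) := by
  have e := (Ideal.quotEquivOfEq (AdicCompletion.ker_evalOneₐ_eq_map 𝔐 fg).symm).trans
    (RingHom.quotientKerEquivOfSurjective (AdicCompletion.evalOneₐ_surjective 𝔐))
  exact e.symm.isSemisimpleRing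

end Completion

end

section

section BaseChange

variable {R : Type} [CommRing R] (T : Type) [CommRing T] [Algebra R T] [Module.Flat R T]

/-- Over a Noetherian ring, flat base change preserves injectivity over the base. -/
theorem injective_tensorProduct [IsNoetherianRing R] (I : Type) [AddCommGroup I] [Module R I] [Module.Injective R I] :
    Module.Injective R (T ⊗[R] I) := by
  refine Module.Baer.injective fun 𝔞 g ↦ ?_
  have : Module.FinitePresentation R 𝔞 := Module.finitePresentation_of_finite R 𝔞
  suffices h : ∀ G : T ⊗[R] 𝔞 →ₗ[T] T ⊗[R] I, ∃ G' : R →ₗ[R] T ⊗[R] I, ∀ x (hx : x ∈ 𝔞), G' x = G (1 ⊗ₜ ⟨x, hx⟩) by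
    obtain ⟨G', hG'⟩ := h (g.liftBaseChange T)
    exact ⟨G', fun x hx ↦ by simp [hG' x hx]⟩
  intro G
  refine (Module.FinitePresentation.isBaseChange_map R 𝔞 I T).inductionOn G _ ?_ ?_ ?_ ?_
  · exact ⟨0, by simp⟩
  · intro f
    obtain ⟨f', hf'⟩ := Module.Baer.of_injective (R := R) (Q := I) inferInstance 𝔞 f
    exact ⟨TensorProduct.mk R T I 1 ∘ₗ f', fun x hx ↦ by simp [hf' x hx, LinearMap.baseChangeHom]⟩
  · rintro t G ⟨G', h⟩
    exact ⟨t • G', fun x hx ↦ by simp [h x hx]⟩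
  · rintro G₁ G₂ ⟨G₁', h₁⟩ ⟨G₂', h₂⟩
    exact ⟨G₁' + G₂', fun x hx ↦ by simp [h₁ x hx, h₂ x hx]⟩

/-- Injective modules over a flat algebra are injective over the base. -/
theorem injective_of_flat (E : Type) [AddCommGroup E] [Module R E] [Module T E] [IsScalarTower R T E]
    [Module.Injective T E] : Module.Injective R E where
  out {X Y} _ _ _ _ f hf g := by
    obtain ⟨h, hh⟩ := Module.Injective.out (R := T) (f.baseChange T)
      (Module.Flat.lTensor_preserves_injective_linearMap (M := T) f hf) (g.liftBaseChange T)
    refine ⟨h.restrictScalars R ∘ₗ TensorProduct.mk R T Y 1, fun x ↦ ?_⟩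
    simpa using hh (1 ⊗ₜ x)

variable (c : Ideal R)

lemma range_lTensor_Gam [IsNoetherianRing R] (M : Type) [AddCommGroup M] [Module R M] :
    LinearMap.range (LinearMap.lTensor T (Gam c M).subtype) = Gam c (T ⊗[R] M) := by
  apply le_antisymm
  · rintro _ ⟨z, rfl⟩
    induction z with
    | zero => simp
    | add z w hz hw => rw [map_add]; exact add_mem hz hw
    | tmul t x =>
      obtain ⟨k, hk⟩ := mem_Gam.1 x.2
      refine mem_Gam.2 ⟨k, fun a ha ↦ ?_⟩
      rw [LinearMap.lTensor_tmul, ← TensorProduct.tmul_smul]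
      simp [hk a ha]
  · intro z hz
    obtain ⟨k, hk⟩ := mem_Gam.1 hz
    obtain ⟨s, hs⟩ := (IsNoetherian.noetherian (c ^ k) : (c ^ k).FG)
    classical
    let φ : M →ₗ[R] (s → M) := LinearMap.pi fun a ↦ LinearMap.lsmul R M a
    have hex : Function.Exact (LinearMap.ker φ).subtype φ := LinearMap.exact_subtype_ker_map φ
    have h1 : LinearMap.lTensor T φ z = 0 := by
      apply (TensorProduct.piRight R R T fun _ : s ↦ M).injective
      ext a
      rw [map_zero, Pi.zero_apply, ← hk a (hs ▸ Ideal.subset_span a.2)]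
      clear hk hz
      induction z with
      | zero => simp
      | add z w hz hw => simp only [map_add, Pi.add_apply, hz, hw, smul_add]
      | tmul t x => simp [φ]
    obtain ⟨w, rfl⟩ := (Module.Flat.lTensor_exact T hex z).1 h1
    have hle : LinearMap.ker φ ≤ Gam c M := by
      intro x hx
      have h2 : ∀ a ∈ s, a • x = 0 := fun a ha ↦ congrFun (LinearMap.mem_ker.1 hx) ⟨a, ha⟩
      refine mem_Gam.2 ⟨k, fun a ha ↦ ?_⟩
      rw [← hs] at ha
      have h3 : Ideal.span (s : Set R) ≤ LinearMap.ker (LinearMap.toSpanSingleton R M x) :=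
        Ideal.span_le.2 fun a ha ↦ by simpa using h2 a ha
      simpa using h3 ha
    refine ⟨LinearMap.lTensor T (Submodule.inclusion hle) w, ?_⟩
    rw [← LinearMap.comp_apply, ← LinearMap.lTensor_comp]
    rfl

/-- Torsion commutes with flat base change. -/
noncomputable def gamTensor [IsNoetherianRing R] (M : Type) [AddCommGroup M] [Module R M] :
    T ⊗[R] Gam c M ≃ₗ[R] Gam c (T ⊗[R] M) :=
  (LinearEquiv.ofInjective (LinearMap.lTensor T (Gam c M).subtype)
    (Module.Flat.lTensor_preserves_injective_linearMap _ (Gam c M).injective_subtype)).trans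
    (LinearEquiv.ofEq _ _ (range_lTensor_Gam T c M))

lemma gamTensor_apply [IsNoetherianRing R] (M : Type) [AddCommGroup M] [Module R M] (z : T ⊗[R] Gam c M) :
    (gamTensor T c M z : T ⊗[R] M) = LinearMap.lTensor T (Gam c M).subtype z := rfl

lemma gmap_gamTensor [IsNoetherianRing R] {M N : Type} [AddCommGroup M] [Module R M] [AddCommGroup N] [Module R N]
    (f : M →ₗ[R] N) (z : T ⊗[R] Gam c M) :
    gmap c (LinearMap.lTensor T f) (gamTensor T c M z) = gamTensor T c N (LinearMap.lTensor T (gmap c f) z) := by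
  ext
  rw [gamTensor_apply, ← LinearMap.comp_apply, ← LinearMap.lTensor_comp]
  change LinearMap.lTensor T f (gamTensor T c M z : T ⊗[R] M) = _
  rw [gamTensor_apply, ← LinearMap.comp_apply, ← LinearMap.lTensor_comp]
  rfl

/-- Local cohomology commutes with flat base change of the module. -/
theorem tensor_topLC [IsNoetherianRing R] (n : ℕ) : ∀ (M : Type) [AddCommGroup M] [Module R M],
    Nonempty (T ⊗[R] TopLC R c n M ≃ₗ[R] TopLC R c n (T ⊗[R] M)) := by
  induction n with
  | zero => exact fun M _ _ ↦ ⟨((zeroth c M).lTensor T).trans ((gamTensor T c M).trans (zeroth c (T ⊗[R] M)).symm)⟩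
  | succ n ih =>
    intro M _ _
    obtain ⟨I, _, _, _, f, hf⟩ := exists_injective R M
    let g := (LinearMap.range f).mkQ
    have hg : Function.Surjective g := Submodule.mkQ_surjective _
    have he : Function.Exact f g := LinearMap.exact_map_mkQ_range f
    have := injective_tensorProduct (R := R) T I
    have : ∀ n, Subsingleton (TopLC R c (n + 1) I) := fun n ↦ subsingleton_of_injective
    have : ∀ n, Subsingleton (TopLC R c (n + 1) (T ⊗[R] I)) := fun n ↦ subsingleton_of_injective
    have hf' : Function.Injective (LinearMap.lTensor T f) := Module.Flat.lTensor_preserves_injective_linearMap f hf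
    have he' : Function.Exact (LinearMap.lTensor T f) (LinearMap.lTensor T g) := lTensor_exact T he hg
    have hg' : Function.Surjective (LinearMap.lTensor T g) := LinearMap.lTensor_surjective T hg
    cases n with
    | zero =>
      obtain ⟨e₁⟩ := shift_one (c := c) hf he hg
      obtain ⟨e₂⟩ := shift_one (c := c) hf' he' hg'
      let π := LinearMap.lTensor T (LinearMap.range (gmap c g)).mkQ
      have hπ : Function.Surjective π := LinearMap.lTensor_surjective T (Submodule.mkQ_surjective _)
      have hk : (LinearMap.ker π).map (gamTensor T c (I ⧸ LinearMap.range f)).toLinearMap =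
          LinearMap.range (gmap c (LinearMap.lTensor T g)) := by
        rw [LinearMap.exact_iff.1 (lTensor_exact T (LinearMap.exact_map_mkQ_range (gmap c g))
          (Submodule.mkQ_surjective _)), ← LinearMap.range_comp]
        have : (gamTensor T c (I ⧸ LinearMap.range f)).toLinearMap ∘ₗ LinearMap.lTensor T (gmap c g) =
            gmap c (LinearMap.lTensor T g) ∘ₗ (gamTensor T c I).toLinearMap :=
          LinearMap.ext fun z ↦ (gmap_gamTensor T c g z).symm
        rw [this, LinearMap.range_comp_of_range_eq_top _ (LinearEquiv.range _)]
      exact ⟨(e₁.symm.lTensor T).trans ((π.quotKerEquivOfSurjective hπ).symm.trans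
        ((Submodule.Quotient.equiv _ _ (gamTensor T c (I ⧸ LinearMap.range f)) hk).trans e₂))⟩
    | succ n =>
      obtain ⟨e₁⟩ := shift_succ (c := c) (n := n) hf he hg
      obtain ⟨e₂⟩ := shift_succ (c := c) (n := n) hf' he' hg'
      obtain ⟨e⟩ := ih (I ⧸ LinearMap.range f)
      exact ⟨(e₁.symm.lTensor T).trans (e.trans e₂)⟩

end BaseChange

end

section

section Restrict

variable {R : Type} [CommRing R] {T : Type} [CommRing T] [Algebra R T] (c : Ideal R)

lemma Gam_restrictScalars (N : Type) [AddCommGroup N] [Module R N] [Module T N] [IsScalarTower R T N] :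
    Gam c N = (Gam (c.map (algebraMap R T)) N).restrictScalars R := by
  ext x
  rw [Submodule.restrictScalars_mem, mem_Gam, mem_Gam]
  refine exists_congr fun k ↦ ⟨fun h ↦ ?_, fun h a ha ↦ ?_⟩
  · rw [← Ideal.map_pow]
    have : Ideal.map (algebraMap R T) (c ^ k) ≤ LinearMap.ker (LinearMap.toSpanSingleton T N x) :=
      Ideal.map_le_iff_le_comap.2 fun a ha ↦ by simpa using h a ha
    exact fun a ha ↦ by simpa using this ha
  · rw [← algebraMap_smul T a x]
    exact h _ (by rw [← Ideal.map_pow]; exact Ideal.mem_map_of_mem _ ha)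

/-- Torsion with respect to an ideal and its extension agree. -/
noncomputable def gamRestrict (N : Type) [AddCommGroup N] [Module R N] [Module T N] [IsScalarTower R T N] :
    Gam c N ≃ₗ[R] Gam (c.map (algebraMap R T)) N :=
  (LinearEquiv.ofEq _ _ (Gam_restrictScalars c N)).trans ((Submodule.restrictScalarsEquiv R T N _).restrictScalars R)

/-- Independence of base for local cohomology, for a flat algebra. -/
theorem topLC_restrictScalars [Module.Flat R T] (n : ℕ) : ∀ (N : Type) [AddCommGroup N] [Module R N] [Module T N]
    [IsScalarTower R T N], ∃ e : TopLC R c n N ≃+ TopLC T (c.map (algebraMap R T)) n N,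
      ∀ (r : R) x, e (r • x) = algebraMap R T r • e x := by
  induction n with
  | zero =>
    intro N _ _ _ _
    refine ⟨((zeroth c N).trans (gamRestrict (T := T) c N)).toAddEquiv.trans
      (zeroth (c.map (algebraMap R T)) N).symm.toAddEquiv, fun r x ↦ ?_⟩
    change (zeroth (c.map (algebraMap R T)) N).symm (((zeroth c N).trans (gamRestrict (T := T) c N)) (r • x)) = _
    rw [map_smul, ← algebraMap_smul T, map_smul]
    rfl
  | succ n ih =>
    intro N _ _ _ _
    obtain ⟨I, _, _, _, f, hf⟩ := exists_injective T N
    let _ : Module R I := Module.compHom I (algebraMap R T)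
    have : IsScalarTower R T I := IsScalarTower.of_compHom R T I
    let g := (LinearMap.range f).mkQ
    have hg : Function.Surjective g := Submodule.mkQ_surjective _
    have he : Function.Exact f g := LinearMap.exact_map_mkQ_range f
    have := injective_of_flat (R := R) T I
    have : ∀ n, Subsingleton (TopLC R c (n + 1) I) := fun n ↦ subsingleton_of_injective
    have : ∀ n, Subsingleton (TopLC T (c.map (algebraMap R T)) (n + 1) I) := fun n ↦ subsingleton_of_injective
    cases n with
    | zero =>
      obtain ⟨e₁⟩ := shift_one (c := c) (f := f.restrictScalars R) (g := g.restrictScalars R) hf he hg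
      obtain ⟨e₂⟩ := shift_one (c := c.map (algebraMap R T)) hf he hg
      have hk : (LinearMap.range (gmap c (g.restrictScalars R))).map
          (gamRestrict (T := T) c (I ⧸ LinearMap.range f)).toLinearMap =
          (LinearMap.range (gmap (c.map (algebraMap R T)) g)).restrictScalars R := by
        have h1 : (gamRestrict (T := T) c (I ⧸ LinearMap.range f)).toLinearMap ∘ₗ gmap c (g.restrictScalars R) =
            (gmap (c.map (algebraMap R T)) g).restrictScalars R ∘ₗ (gamRestrict (T := T) c I).toLinearMap := rfl
        rw [← LinearMap.range_comp, h1, LinearMap.range_comp_of_range_eq_top _ (LinearEquiv.range _)]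
        rfl
      let e := e₁.symm.trans ((Submodule.Quotient.equiv _ _ (gamRestrict (T := T) c (I ⧸ LinearMap.range f)) hk).trans
        (Submodule.Quotient.restrictScalarsEquiv R _))
      refine ⟨e.toAddEquiv.trans e₂.toAddEquiv, fun r x ↦ ?_⟩
      change e₂ (e (r • x)) = _
      rw [map_smul, ← algebraMap_smul T, map_smul]
      rfl
    | succ n =>
      obtain ⟨e₁⟩ := shift_succ (c := c) (n := n) (f := f.restrictScalars R) (g := g.restrictScalars R) hf he hg
      obtain ⟨e₂⟩ := shift_succ (c := c.map (algebraMap R T)) (n := n) hf he hg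
      obtain ⟨e, h⟩ := ih (I ⧸ LinearMap.range f)
      refine ⟨e₁.symm.toAddEquiv.trans (e.trans e₂.toAddEquiv), fun r x ↦ ?_⟩
      change e₂ (e (e₁.symm (r • x))) = _
      rw [map_smul, h, map_smul]
      rfl

end Restrict

section Torsion

variable {R : Type} [CommRing R] {𝔐 : Ideal R}

/-- A torsion module is isomorphic to its base change to the completion. -/
theorem tensor_completion_equiv (fg : 𝔐.FG) [Module.Flat R (AdicCompletion 𝔐 R)] {H : Type} [AddCommGroup H]
    [Module R H] (hH : IsTors 𝔐 H) : Nonempty (H ≃ₗ[R] AdicCompletion 𝔐 R ⊗[R] H) := by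
  let T := AdicCompletion 𝔐 R
  have hk : ∀ (k : ℕ) (t : T), ∃ r : R, t - algebraMap R T r ∈ (𝔐 ^ k).map (algebraMap R T) := by
    intro k t
    obtain ⟨r, hr⟩ := Submodule.mkQ_surjective _ (AdicCompletion.eval 𝔐 R k t)
    refine ⟨r, ?_⟩
    have h1 : t - algebraMap R T r ∈ LinearMap.ker (AdicCompletion.eval 𝔐 R k) := by
      rw [LinearMap.mem_ker, map_sub, sub_eq_zero, ← hr]
      rfl
    rw [← AdicCompletion.pow_smul_top_eq_ker_eval fg, Ideal.smul_top_eq_map] at h1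
    exact h1
  let ι : H →ₗ[R] T ⊗[R] H := TensorProduct.mk R T H 1
  refine ⟨LinearEquiv.ofBijective ι ⟨?_, ?_⟩⟩
  · rw [injective_iff_map_eq_zero]
    intro x hx
    obtain ⟨k, hkx⟩ := hH x
    let 𝔞 : Ideal R := LinearMap.ker (LinearMap.toSpanSingleton R H x)
    have h𝔞 : 𝔐 ^ k ≤ 𝔞 := fun a ha ↦ by simpa [𝔞] using hkx a ha
    let ψ : T →ₐ[R] R ⧸ 𝔞 := (Ideal.Quotient.factorₐ R h𝔞).comp (AdicCompletion.evalₐ 𝔐 k)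
    let j : (R ⧸ 𝔞) →ₗ[R] H := 𝔞.liftQ (LinearMap.toSpanSingleton R H x) le_rfl
    have hj : Function.Injective j := LinearMap.ker_eq_bot.1 (Submodule.ker_liftQ_eq_bot _ _ _ le_rfl)
    have h1 : (1 : T) ⊗ₜ[R] (1 : R ⧸ 𝔞) = 0 := by
      apply Module.Flat.lTensor_preserves_injective_linearMap (M := T) j hj
      rw [map_zero, ← hx, LinearMap.lTensor_tmul]
      change _ = (1 : T) ⊗ₜ[R] x
      congr 1
      exact one_smul R x
    have h2 := congrArg (LinearMap.mul' R (R ⧸ 𝔞) ∘ₗ LinearMap.rTensor _ ψ.toLinearMap) h1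
    have h3 : (1 : R ⧸ 𝔞) = 0 := by simpa using h2
    have h4 : (1 : R) ∈ 𝔞 := Ideal.Quotient.eq_zero_iff_mem.1 h3
    simpa [𝔞] using h4
  · intro z
    induction z with
    | zero => exact ⟨0, map_zero _⟩
    | add z w hz hw =>
      obtain ⟨x, rfl⟩ := hz
      obtain ⟨y, rfl⟩ := hw
      exact ⟨x + y, map_add _ _ _⟩
    | tmul t x =>
      obtain ⟨k, hkx⟩ := hH x
      obtain ⟨r, hr⟩ := hk k t
      refine ⟨r • x, ?_⟩
      have h1 : ∀ s ∈ (𝔐 ^ k).map (algebraMap R T), s ⊗ₜ[R] x = 0 := by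
        intro s hs
        have : (𝔐 ^ k).map (algebraMap R T) ≤ LinearMap.ker (LinearMap.toSpanSingleton T (T ⊗[R] H) (1 ⊗ₜ x)) := by
          refine Ideal.map_le_iff_le_comap.2 fun a ha ↦ ?_
          simp [algebraMap_smul, ← TensorProduct.tmul_smul, hkx a ha]
        simpa [TensorProduct.smul_tmul'] using this hs
      have h2 := h1 _ hr
      rw [TensorProduct.sub_tmul, sub_eq_zero] at h2
      rw [h2, map_smul, Algebra.algebraMap_eq_smul_one, TensorProduct.smul_tmul, TensorProduct.tmul_smul]
      rfl

end Torsion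

end

section

section Dimension

/-- If every maximal ideal of `B` is extended from `A`, then `dim B ≤ dim A`. -/
lemma ringKrullDim_le_of_map_comap {A B : Type} [CommRing A] [CommRing B] [IsNoetherianRing B] [IsNoetherianRing A]
    [Algebra A B] (h : ∀ n : Ideal B, n.IsMaximal → n ≤ (n.comap (algebraMap A B)).map (algebraMap A B)) :
    ringKrullDim B ≤ ringKrullDim A := by
  rw [ringKrullDim_le_iff_isMaximal_height_le]
  intro n hn
  let m := n.comap (algebraMap A B)
  have : m.IsPrime := inferInstance
  have : n.LiesOver m := ⟨rfl⟩
  have h1 := Ideal.height_le_height_add_of_liesOver m n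
  have h2 : n.map (Ideal.Quotient.mk (m.map (algebraMap A B))) = ⊥ := by
    rw [Ideal.map_eq_bot_iff_le_ker, Ideal.mk_ker]
    exact h n hn
  have : Nontrivial (B ⧸ m.map (algebraMap A B)) :=
    Ideal.Quotient.nontrivial_iff.2 (ne_top_of_le_ne_top hn.ne_top Ideal.map_comap_le)
  rw [h2, Ideal.height_bot, add_zero] at h1
  exact (WithBot.coe_le_coe.2 h1).trans (Ideal.height_le_ringKrullDim_of_ne_top Ideal.IsPrime.ne_top')

lemma map_annihilator_le {R : Type} [CommRing R] (M : Type) [AddCommGroup M] [Module R M] {T : Type} [CommRing T] [Algebra R T] :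
    (Module.annihilator R M).map (algebraMap R T) ≤ Module.annihilator T (T ⊗[R] M) := by
  refine Ideal.map_le_iff_le_comap.2 fun a ha ↦ Module.mem_annihilator.2 fun z ↦ ?_
  rw [algebraMap_smul]
  induction z with
  | zero => simp
  | add z w hz hw => rw [smul_add, hz, hw, add_zero]
  | tmul t x => rw [← TensorProduct.tmul_smul, Module.mem_annihilator.1 ha, TensorProduct.tmul_zero]

variable {R : Type} [CommRing R] [IsNoetherianRing R] {𝔐 : Ideal R}

lemma ringKrullDim_completion_quotient_le [IsSemisimpleRing (R ⧸ 𝔐)] (𝔞 : Ideal R) :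
    ringKrullDim (AdicCompletion 𝔐 R ⧸ 𝔞.map (algebraMap R (AdicCompletion 𝔐 R))) ≤ ringKrullDim (R ⧸ 𝔞) := by
  have fg : 𝔐.FG := IsNoetherian.noetherian 𝔐
  let T := AdicCompletion 𝔐 R
  have : IsNoetherianRing T := isNoetherianRing_adicCompletion 𝔐
  let J : Ideal T := 𝔐.map (algebraMap R T)
  have : IsAdicComplete J T := AdicCompletion.isAdicComplete_self 𝔐 fg
  refine ringKrullDim_le_of_map_comap (A := R ⧸ 𝔞) (B := T ⧸ 𝔞.map (algebraMap R T)) fun n' hn' ↦ ?_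
  let π := Ideal.Quotient.mk (𝔞.map (algebraMap R T))
  let n := n'.comap π
  have hn : n.IsMaximal := Ideal.comap_isMaximal_of_surjective π Ideal.Quotient.mk_surjective
  have hJn : J ≤ n := (IsAdicComplete.le_jacobson_bot J).trans (Ideal.jacobson_bot.le.trans (Ring.jacobson_le_of_isMaximal n))
  let m := n.comap (algebraMap R T)
  have hm : 𝔐 ≤ m := Ideal.map_le_iff_le_comap.1 hJn
  have hmax : m.IsMaximal := isMaximal_of_le_of_isSemisimpleRing ⟨m, inferInstance⟩ hm
  have hmT : (m.map (algebraMap R T)).IsMaximal := AdicCompletion.isMaximal_map_of_le 𝔐 m hm fg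
  have hnm : n = m.map (algebraMap R T) := (hmT.eq_of_le hn.ne_top Ideal.map_comap_le).symm
  refine (Ideal.map_comap_of_surjective π Ideal.Quotient.mk_surjective n').ge.trans ?_
  change n.map π ≤ _
  rw [hnm, Ideal.map_map, Ideal.map_le_iff_le_comap]
  intro x hx
  have hx' : π (algebraMap R T x) ∈ n' := hx
  exact Ideal.mem_map_of_mem (algebraMap (R ⧸ 𝔞) (T ⧸ 𝔞.map (algebraMap R T))) (x := Ideal.Quotient.mk 𝔞 x) hx'

lemma coheight_le_ringKrullDim {T : Type} [CommRing T] {I : Ideal T} {q : PrimeSpectrum T} (hq : I ≤ q.asIdeal) :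
    (Order.coheight q : WithBot ℕ∞) ≤ ringKrullDim (T ⧸ I) := by
  rw [Order.coheight_eq_krullDim_Ici, ringKrullDim_quotient]
  exact Order.krullDim_le_of_strictMono (fun p ↦ ⟨p.1, hq.trans p.2⟩) fun _ _ h ↦ h

lemma ringKrullDim_quotient_eq_coheight {T : Type} [CommRing T] (q : PrimeSpectrum T) :
    ringKrullDim (T ⧸ q.asIdeal) = Order.coheight q := by
  rw [Order.coheight_eq_krullDim_Ici, ringKrullDim_quotient]
  rfl

variable (M : Type) [AddCommGroup M] [Module R M] [Module.Finite R M] {d : ℕ} (hd : moduleDim R M = d)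

include hd in
lemma ringKrullDim_completion_le [IsSemisimpleRing (R ⧸ 𝔐)] :
    ringKrullDim (AdicCompletion 𝔐 R ⧸ (Module.annihilator R M).map (algebraMap R (AdicCompletion 𝔐 R))) ≤ d := by
  refine (ringKrullDim_completion_quotient_le _).trans ?_
  rw [← hd, ringKrullDim_quotient, ← Module.support_eq_zeroLocus]
  rfl

include hd in
lemma coheight_le_of_mem_support [IsSemisimpleRing (R ⧸ 𝔐)] {q : PrimeSpectrum (AdicCompletion 𝔐 R)}
    (hq : q ∈ Module.support _ (AdicCompletion 𝔐 R ⊗[R] M)) : Order.coheight q ≤ d := by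
  have h0 := map_annihilator_le (R := R) M (T := AdicCompletion 𝔐 R)
  have h1 := h0.trans (Module.annihilator_le_of_mem_support hq)
  have h2 := coheight_le_ringKrullDim h1
  have h3 := h2.trans (ringKrullDim_completion_le M hd)
  exact WithBot.coe_le_coe.1 h3

include hd in
lemma mem_Assh_of_coheight_eq [IsSemisimpleRing (R ⧸ 𝔐)] {q : PrimeSpectrum (AdicCompletion 𝔐 R)}
    (hq : q ∈ Module.support _ (AdicCompletion 𝔐 R ⊗[R] M)) (hqd : Order.coheight q = d) :
    q.asIdeal ∈ Assh (AdicCompletion 𝔐 R) (AdicCompletion 𝔐 R ⊗[R] M) := by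
  have := isNoetherianRing_adicCompletion 𝔐
  constructor
  · apply Module.associatedPrimes.minimalPrimes_annihilator_subset_associatedPrimes
    refine ⟨⟨q.2, Module.annihilator_le_of_mem_support hq⟩, fun p ⟨hp, hpN⟩ hpq ↦ ?_⟩
    have hpS : (⟨p, hp⟩ : PrimeSpectrum _) ∈ Module.support (AdicCompletion 𝔐 R) (AdicCompletion 𝔐 R ⊗[R] M) :=
      Module.mem_support_iff_of_finite.2 hpN
    by_contra hne
    have h1 := Order.coheight_le_coe_iff.1 (coheight_le_of_mem_support M hd hpS) q (lt_of_le_not_ge hpq hne)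
    exact h1.ne hqd
  · rw [ringKrullDim_quotient_eq_coheight]
    apply le_antisymm
    · rw [Order.coheight_eq_krullDim_Ici]
      exact Order.krullDim_le_of_strictMono (fun p ↦ ⟨p.1, Module.mem_support_mono p.2 hq⟩) fun _ _ h ↦ h
    · rw [hqd]
      refine le_trans ?_ (ringKrullDim_completion_le (𝔐 := 𝔐) M hd)
      rw [ringKrullDim_quotient]
      exact Order.krullDim_le_of_strictMono (fun p ↦
        ⟨p.1, (map_annihilator_le M).trans (Module.annihilator_le_of_mem_support p.2)⟩) fun _ _ h ↦ h

end Dimension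

section Support

variable {R : Type} [CommRing R]

lemma le_of_mem_support_topLC {c : Ideal R} {d : ℕ} {M : Type} [AddCommGroup M] [Module R M] {p : PrimeSpectrum R}
    (hp : p ∈ Module.support R (TopLC R c d M)) : c ≤ p.asIdeal := by
  obtain ⟨x, hx⟩ := Module.mem_support_iff_exists_annihilator.1 hp
  obtain ⟨k, hk⟩ := isTors_topLC c d M x
  refine p.2.le_of_pow_le (n := k) (le_trans (fun a ha ↦ ?_) hx)
  simpa [Submodule.mem_annihilator_span_singleton] using hk a ha

lemma isTors_of_support [IsNoetherianRing R] {𝔐 : Ideal R} {H : Type} [AddCommGroup H] [Module R H]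
    (h : ∀ p ∈ Module.support R H, 𝔐 ≤ p.asIdeal) : IsTors 𝔐 H := by
  intro x
  have h1 : 𝔐 ≤ (Submodule.span R {x}).annihilator.radical := by
    rw [Ideal.radical_eq_sInf, le_sInf_iff]
    rintro p ⟨hp, hpp⟩
    exact h ⟨p, hpp⟩ (Module.mem_support_iff_exists_annihilator.2 ⟨x, hp⟩)
  obtain ⟨k, hk⟩ := Ideal.exists_pow_le_of_le_radical_of_fg h1 (IsNoetherian.noetherian 𝔐)
  exact ⟨k, fun b hb ↦ by simpa [Submodule.mem_annihilator_span_singleton] using hk hb⟩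

end Support

end

section

section Final

variable {R : Type} [CommRing R] [IsNoetherianRing R]

/-- Local cohomology modules over `R` that are `𝔐`-torsion agree as soon as they agree after completion. -/
lemma topLC_equiv_of_completion {𝔐 : Ideal R} (M : Type) [AddCommGroup M] [Module R M] {d : ℕ} {c₁ c₂ : Ideal R}
    (h₁ : IsTors 𝔐 (TopLC R c₁ d M)) (h₂ : IsTors 𝔐 (TopLC R c₂ d M))
    (h : Nonempty (TopLC (AdicCompletion 𝔐 R) (c₁.map (algebraMap R (AdicCompletion 𝔐 R))) d (AdicCompletion 𝔐 R ⊗[R] M)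
      ≃ₗ[AdicCompletion 𝔐 R]
        TopLC (AdicCompletion 𝔐 R) (c₂.map (algebraMap R (AdicCompletion 𝔐 R))) d (AdicCompletion 𝔐 R ⊗[R] M))) :
    Nonempty (TopLC R c₁ d M ≃ₗ[R] TopLC R c₂ d M) := by
  have fl : Module.Flat R (AdicCompletion 𝔐 R) := AdicCompletion.flat_of_isNoetherian 𝔐
  have fg : 𝔐.FG := IsNoetherian.noetherian 𝔐
  obtain ⟨a₁⟩ := tensor_completion_equiv fg h₁
  obtain ⟨a₂⟩ := tensor_completion_equiv fg h₂
  obtain ⟨b₁⟩ := tensor_topLC (R := R) (AdicCompletion 𝔐 R) c₁ d M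
  obtain ⟨b₂⟩ := tensor_topLC (R := R) (AdicCompletion 𝔐 R) c₂ d M
  obtain ⟨e₁, he₁⟩ := topLC_restrictScalars (R := R) (T := AdicCompletion 𝔐 R) c₁ d (AdicCompletion 𝔐 R ⊗[R] M)
  obtain ⟨e₂, he₂⟩ := topLC_restrictScalars (R := R) (T := AdicCompletion 𝔐 R) c₂ d (AdicCompletion 𝔐 R ⊗[R] M)
  obtain ⟨g⟩ := h
  let k := (e₁.trans g.toAddEquiv).trans e₂.symm
  have hk : ∀ (r : R) x, k (r • x) = r • k x := fun r x ↦ by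
    apply e₂.injective
    rw [he₂]
    change e₂ (e₂.symm (g (e₁ (r • x)))) = _ • e₂ (e₂.symm (g (e₁ x)))
    rw [e₂.apply_symm_apply, e₂.apply_symm_apply, he₁]
    exact g.map_smul _ _
  exact ⟨a₁.trans <| b₁.trans <| (k.toLinearEquiv hk).trans <| b₂.symm.trans a₂.symm⟩

end Final

end

end LC

/-- With `P` a finite set of maximal ideals, `𝔐 = ∩_{m ∈ P} m` and `T` the
`𝔐`-adic completion of `R`, the number of isomorphism classes of `R`-modules among the
`H^d_c(M)`, as `c` ranges over the ideals with `Supp_R H^d_c(M) = P`, is at most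
`2^{|Assh_T(M ⊗_R T)|}`: there is a function to `Fin (2 ^ |Assh_T(T ⊗[R] M)|)` whose fibers
consist of pairwise isomorphic top local cohomology modules. -/
theorem stmt_18 (R : Type) [CommRing R] [IsNoetherianRing R]
    (M : Type) [AddCommGroup M] [Module R M] [Module.Finite R M]
    (d : ℕ) (hd : moduleDim R M = (d : WithBot ℕ∞))
    (P : Set (PrimeSpectrum R)) (hPfin : P.Finite) (hPmax : ∀ p ∈ P, p.asIdeal.IsMaximal)
    (𝔐 : Ideal R) (h𝔐 : 𝔐 = ⨅ p ∈ P, p.asIdeal) :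
    ∃ f : {c : Ideal R // Module.support R (TopLC R c d M) = P} →
        Fin (2 ^ (Assh (AdicCompletion 𝔐 R) ((AdicCompletion 𝔐 R) ⊗[R] M)).ncard),
      ∀ c₁ c₂, f c₁ = f c₂ →
        Nonempty ((TopLC R c₁.1 d M) ≃ₗ[R] (TopLC R c₂.1 d M)) := by
  have noeth := LC.isNoetherianRing_adicCompletion 𝔐
  have fg : 𝔐.FG := IsNoetherian.noetherian 𝔐
  have ss : IsSemisimpleRing (R ⧸ 𝔐) := LC.isSemisimpleRing_quotient hPfin hPmax h𝔐
  have ssT := LC.isSemisimpleRing_completion_quotient fg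
  have cpl := AdicCompletion.isAdicComplete_self 𝔐 fg
  let φ := algebraMap R (AdicCompletion 𝔐 R)
  let X := Assh (AdicCompletion 𝔐 R) ((AdicCompletion 𝔐 R) ⊗[R] M)
  let S : Ideal R → Set (Ideal (AdicCompletion 𝔐 R)) := fun c ↦ {q ∈ X | 𝔐.map φ ≤ (c.map φ ⊔ q).radical}
  have hX : X.Finite :=
    (associatedPrimes.finite (AdicCompletion 𝔐 R) (AdicCompletion 𝔐 R ⊗[R] M)).subset fun q hq ↦ hq.1
  have : Finite (𝒫 X) := hX.finite_subsets
  let e : 𝒫 X ≃ Fin (2 ^ X.ncard) :=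
    Finite.equivFinOfCardEq ((Nat.card_coe_set_eq _).trans (Set.ncard_powerset X hX))
  have hle : ∀ c : {c : Ideal R // Module.support R (TopLC R c d M) = P}, c.1.map φ ≤ 𝔐.map φ := fun c ↦
    Ideal.map_mono (h𝔐 ▸ le_iInf₂ fun p hp ↦ LC.le_of_mem_support_topLC (c.2.symm ▸ hp))
  have htors : ∀ c : {c : Ideal R // Module.support R (TopLC R c d M) = P}, LC.IsTors 𝔐 (TopLC R c.1 d M) := fun c ↦
    LC.isTors_of_support fun p hp ↦ h𝔐.trans_le (iInf₂_le p (c.2 ▸ hp))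
  refine ⟨fun c ↦ e ⟨S c.1, Set.sep_subset _ _⟩, fun c₁ c₂ h ↦ ?_⟩
  have hS : S c₁.1 = S c₂.1 := congrArg Subtype.val (e.injective h)
  refine LC.topLC_equiv_of_completion M (htors c₁) (htors c₂) ?_
  refine LC.topLC_equiv_of_radical (J := 𝔐.map φ) (fun q hq ↦ LC.coheight_le_of_mem_support M hd hq)
    (hle c₁) (hle c₂) fun q hq hqd ↦ ?_
  have hqX : q.asIdeal ∈ X := LC.mem_Assh_of_coheight_eq M hd hq hqd
  have := Set.ext_iff.1 hS q.asIdeal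
  simpa [S, hqX] using this
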